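/- Fix an integer k ≥ 2 and an integer ℓ ≥ 1. Let Y_n^{(ℓ)} be the number of directed cycles of length ℓ of the random k-out digraph 𝒟_{n,k} all of whose vertices lie outside the giant 𝒢. Then Y_n^{(ℓ)} converges in distribution to a Poisson random variable with mean (k μ_k)^ℓ / ℓ; that is, for every m ∈ ℕ, P(Y_n^{(ℓ)} = m) → e^{−λ} λ^m / m! with λ = (k μ_k)^ℓ / ℓ. -/

import Mathlib

open scoped Classical
open Filter MeasureTheory

/-- Probability of an event under the uniform random `k`-out digraph model `𝒟_{n,k}`:
a uniformly random function `f : [n] × [k] → [n]`. -/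
noncomputable def prob (n k : ℕ) (P : (Fin n × Fin k → Fin n) → Prop) : ℝ :=
  ((Finset.univ.filter P).card : ℝ) / (Fintype.card (Fin n × Fin k → Fin n) : ℝ)

/-- One arc step: there is a labeled arc from `u` to `v`. -/
def Step {n k : ℕ} (f : Fin n × Fin k → Fin n) (u v : Fin n) : Prop :=
  ∃ i : Fin k, f (u, i) = v

/-- `u` reaches `v` by following finitely many arcs. -/
def Reaches {n k : ℕ} (f : Fin n × Fin k → Fin n) : Fin n → Fin n → Prop :=
  Relation.ReflTransGen (Step f)

/-- A set of vertices is closed if no arc leaves it. -/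
def IsClosedSet {n k : ℕ} (f : Fin n × Fin k → Fin n) (S : Set (Fin n)) : Prop :=
  ∀ v ∈ S, ∀ i : Fin k, f (v, i) ∈ S

/-- A set of vertices is strongly connected if it is nonempty and
any two of its vertices reach each other. -/
def IsStrConn {n k : ℕ} (f : Fin n × Fin k → Fin n) (S : Set (Fin n)) : Prop :=
  S.Nonempty ∧ ∀ u ∈ S, ∀ v ∈ S, Reaches f u v

/-- `G` is the giant: a closed strongly connected set of maximum size,
ties broken by choosing the one containing the smallest vertex label. -/
def IsGiant {n k : ℕ} (f : Fin n × Fin k → Fin n) (G : Set (Fin n)) : Prop :=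
  IsClosedSet f G ∧ IsStrConn f G ∧
    (∀ S : Set (Fin n), IsClosedSet f S → IsStrConn f S → S.ncard ≤ G.ncard) ∧
    (∀ S : Set (Fin n), IsClosedSet f S → IsStrConn f S → S.ncard = G.ncard →
      ∃ v ∈ G, ∀ u ∈ S, v ≤ u)

/-- Number of directed cycles of length `ℓ` with all vertices in `A`
(cycles are cyclic sequences of distinct vertices, identified up to rotation,
so each cycle corresponds to exactly `ℓ` injective maps `ZMod ℓ → Fin n`). -/
noncomputable def numCycles {n k : ℕ} (f : Fin n × Fin k → Fin n) (A : Set (Fin n)) : ℕ → ℕ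
  | 0 => 0
  | (ℓ + 1) =>
      (Finset.univ.filter fun c : ZMod (ℓ + 1) → Fin n =>
        Function.Injective c ∧ (∀ j, c j ∈ A) ∧
          ∀ j, ∃ i : Fin k, f (c j, i) = c (j + 1)).card / (ℓ + 1)

section Rate

/-- The exponential growth rate, per vertex, of the expected number of closed sets of size `a * n`
onto which the arcs inside the set surject. -/
noncomputable def rate (K ν a : ℝ) : ℝ :=
  -Real.log a + Real.negMulLog (1 - a) / a + K * (Real.log a - Real.log ν) - K
    + Real.log ν - Real.log (1 - ν)

lemma hasDerivAt_rate (K ν : ℝ) {a : ℝ} (h0 : 0 < a) (h1 : a < 1) :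
    HasDerivAt (rate K ν) ((Real.log (1 - a) + K * a) / a ^ 2) a := by
  have h1' : (1 - a) ≠ 0 := by linarith
  have hlog := Real.hasDerivAt_log h0.ne'
  have hneg : HasDerivAt (fun a : ℝ => Real.negMulLog (1 - a))
      ((-Real.log (1 - a) - 1) * (-1)) a :=
    (Real.hasDerivAt_negMulLog h1').comp a ((hasDerivAt_id a).const_sub 1)
  have := ((((hlog.neg.add (hneg.div (hasDerivAt_id a) h0.ne')).add
    ((hlog.sub_const (Real.log ν)).const_mul K)).sub_const K).add_const (Real.log ν)).sub_const
      (Real.log (1 - ν))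
  refine this.congr_deriv ?_
  simp only [id, Real.negMulLog]
  field_simp
  ring

lemma continuousOn_rate (K ν : ℝ) : ContinuousOn (rate K ν) (Set.Ioi 0) := by
  have h : ContinuousOn Real.log (Set.Ioi 0) :=
    Real.continuousOn_log.mono fun x hx => ne_of_gt hx
  have h2 : ContinuousOn (fun a : ℝ => Real.negMulLog (1 - a) / a) (Set.Ioi 0) :=
    ContinuousOn.div (by fun_prop) continuousOn_id fun x hx => ne_of_gt hx
  unfold rate
  fun_prop

lemma rate_self {K ν : ℝ} (h0 : 0 < ν) (hν : Real.log (1 - ν) = -(K * ν)) :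
    rate K ν ν = 0 := by
  simp only [rate, Real.negMulLog, hν]
  field_simp
  ring

lemma mul_log_one_sub_lt {a b : ℝ} (ha : 0 < a) (hab : a < b) (hb : b < 1) :
    a * Real.log (1 - b) < b * Real.log (1 - a) := by
  have hb0 : 0 < b := ha.trans hab
  have := strictConcaveOn_log_Ioi.2 (show 1 - b ∈ Set.Ioi (0 : ℝ) by simp; linarith)
    (show (1 : ℝ) ∈ Set.Ioi (0 : ℝ) by simp) (by linarith)
    (show 0 < a / b by positivity) (show 0 < 1 - a / b by rw [sub_pos, div_lt_one hb0]; exact hab)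
    (by ring)
  have e : (a / b) • (1 - b) + (1 - a / b) • (1 : ℝ) = 1 - a := by
    simp only [smul_eq_mul]; field_simp; ring
  rw [e] at this
  simp only [smul_eq_mul, Real.log_one, mul_zero, add_zero] at this
  rw [div_mul_eq_mul_div, div_lt_iff₀ hb0] at this
  linarith

lemma strictMonoOn_rate {K ν : ℝ} (h1 : ν < 1)
    (hν : Real.log (1 - ν) = -(K * ν)) : StrictMonoOn (rate K ν) (Set.Ioc 0 ν) := by
  refine strictMonoOn_of_deriv_pos (convex_Ioc 0 ν)
    ((continuousOn_rate K ν).mono fun x hx => hx.1) fun x hx => ?_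
  rw [interior_Ioc] at hx
  rw [(hasDerivAt_rate K ν hx.1 (hx.2.trans h1)).deriv]
  have := mul_log_one_sub_lt hx.1 hx.2 h1
  rw [hν] at this
  have hν0 : 0 < ν := hx.1.trans hx.2
  have : 0 < Real.log (1 - x) + K * x := by
    by_contra h
    nlinarith
  have := hx.1
  positivity

lemma strictAntiOn_rate {K ν : ℝ} (h0 : 0 < ν)
    (hν : Real.log (1 - ν) = -(K * ν)) : StrictAntiOn (rate K ν) (Set.Icc ν 1) := by
  refine strictAntiOn_of_deriv_neg (convex_Icc ν 1)
    ((continuousOn_rate K ν).mono fun x hx => h0.trans_le hx.1) fun x hx => ?_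
  rw [interior_Icc] at hx
  have hx0 := h0.trans hx.1
  rw [(hasDerivAt_rate K ν hx0 hx.2).deriv]
  have := mul_log_one_sub_lt h0 hx.1 hx.2
  rw [hν] at this
  have : Real.log (1 - x) + K * x < 0 := by
    by_contra h
    nlinarith
  exact div_neg_of_neg_of_pos this (by positivity)

lemma exists_rate_le {K ν ε : ℝ} (hν : Real.log (1 - ν) = -(K * ν)) (hε : 0 < ε)
    (h0 : 0 < ν - ε) (h1 : ν + ε < 1) :
    ∃ c > 0, ∀ a, 0 < a → a ≤ 1 → ε ≤ |a - ν| → rate K ν a ≤ -c := by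
  have hν0 : 0 < ν := by linarith
  have hm := strictMonoOn_rate (by linarith) hν
  have ha := strictAntiOn_rate hν0 hν
  have hs := rate_self hν0 hν
  have e1 : rate K ν (ν - ε) < 0 := by
    rw [← hs]; exact hm ⟨h0, by linarith⟩ ⟨hν0, le_rfl⟩ (by linarith)
  have e2 : rate K ν (ν + ε) < 0 := by
    rw [← hs]; exact ha ⟨le_rfl, by linarith⟩ ⟨by linarith, h1.le⟩ (by linarith)
  refine ⟨min (-rate K ν (ν - ε)) (-rate K ν (ν + ε)), by simp [e1, e2], fun a a0 a1 hab => ?_⟩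
  rcases le_abs.1 hab with h | h
  · have := ha.antitoneOn (a := ν + ε) (b := a) ⟨by linarith, h1.le⟩ ⟨by linarith, a1⟩
      (by linarith)
    linarith [min_le_right (-rate K ν (ν - ε)) (-rate K ν (ν + ε))]
  · have := hm.monotoneOn (a := a) (b := ν - ε) ⟨a0, by linarith⟩ ⟨h0, by linarith⟩
      (by linarith)
    linarith [min_le_left (-rate K ν (ν - ε)) (-rate K ν (ν + ε))]

lemma half_lt_of_log_one_sub_eq {K ν : ℝ} (hK : 2 ≤ K) (h0 : 0 < ν)
    (hν : Real.log (1 - ν) = -(K * ν)) : 1 / 2 < ν := by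
  by_contra! h
  have hl : -1 < Real.log (1 - 1 / 2) := by
    have := Real.log_two_lt_d9
    rw [show (1 - 1 / 2 : ℝ) = 2⁻¹ by norm_num, Real.log_inv]
    linarith
  rcases h.eq_or_lt with rfl | h
  · linarith
  · have := mul_log_one_sub_lt h0 h (by norm_num)
    rw [hν] at this
    nlinarith

end Rate

section Surjections

lemma card_surjective_fin_mul_pow_le (s : ℕ) {x : ℝ} (hx : 0 < x) :
    ∀ (α : Type) [Fintype α],
      (Fintype.card {g : α → Fin s // Function.Surjective g} : ℝ) * x ^ Fintype.card α ≤
        (Fintype.card α).factorial * (Real.exp x - 1) ^ s := by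
  have hx1 : 0 ≤ Real.exp x - 1 := by linarith [Real.add_one_le_exp x]
  induction s with
  | zero =>
    intro α _
    rcases isEmpty_or_nonempty α with h | h
    · simp [Fintype.card_le_one_iff_subsingleton.2 inferInstance]
    · have : IsEmpty (α → Fin 0) := inferInstance
      simp
  | succ s ih =>
    intro α _
    set N := Fintype.card α with hN
    have key : ∀ T : Finset α,
        Fintype.card {g : α → Fin (s + 1) // Function.Surjective g ∧
          Finset.univ.filter (fun a => g a = 0) = T} ≤
        Fintype.card {g : {a // a ∉ T} → Fin s // Function.Surjective g} := by
      intro T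
      have h0 : ∀ g : {g : α → Fin (s + 1) // Function.Surjective g ∧
          Finset.univ.filter (fun a => g a = 0) = T}, ∀ a, a ∈ T ↔ g.1 a = 0 := by
        rintro ⟨g, hg, rfl⟩ a
        simp
      refine Fintype.card_le_of_injective (fun g => ⟨fun a => (g.1 a.1).pred
        (fun h => a.2 ((h0 g a).2 h)), fun b => ?_⟩) fun g g' h => ?_
      · obtain ⟨a, ha⟩ := g.2.1 b.succ
        refine ⟨⟨a, fun h => ?_⟩, ?_⟩
        · rw [(h0 g a).1 h] at ha
          exact (Fin.succ_ne_zero b) ha.symm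
        · simp [ha]
      · ext a : 2
        by_cases ha : a ∈ T
        · rw [(h0 g a).1 ha, (h0 g' a).1 ha]
        · have := congrFun (Subtype.ext_iff.1 h) ⟨a, ha⟩
          simpa using this
    have hcount : Fintype.card {g : α → Fin (s + 1) // Function.Surjective g} =
        ∑ T : Finset α, Fintype.card {g : α → Fin (s + 1) // Function.Surjective g ∧
          Finset.univ.filter (fun a => g a = 0) = T} := by
      rw [Fintype.card_subtype, Finset.card_eq_sum_card_fiberwise
        (f := fun g : α → Fin (s + 1) => Finset.univ.filter (fun a => g a = 0))
        (t := Finset.univ) (by simp [Set.MapsTo])]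
      refine Finset.sum_congr rfl fun T _ => ?_
      rw [Fintype.card_subtype, Finset.filter_filter]
    have hzero : Fintype.card {g : α → Fin (s + 1) // Function.Surjective g ∧
          Finset.univ.filter (fun a => g a = 0) = ∅} = 0 := by
      rw [Fintype.card_eq_zero_iff]
      refine ⟨fun ⟨g, hg, h⟩ => ?_⟩
      obtain ⟨a, ha⟩ := hg 0
      exact Finset.notMem_empty a (h ▸ by simp [ha])
    let F : ℕ → ℝ := fun t => if t = 0 then 0 else
      (N - t).factorial * (Real.exp x - 1) ^ s * x ^ t
    have hterm : ∀ T : Finset α, (Fintype.card {g : α → Fin (s + 1) // Function.Surjective g ∧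
          Finset.univ.filter (fun a => g a = 0) = T} : ℝ) * x ^ N ≤ F T.card := by
      intro T
      by_cases hT : T = ∅
      · subst hT
        rw [hzero]
        simp [F]
      · have hc : Fintype.card {a // a ∉ T} = N - T.card := by
          rw [Fintype.card_subtype_compl, Fintype.card_coe]
        have hle : T.card ≤ N := Finset.card_le_univ T
        have h1 := ih {a // a ∉ T}
        rw [hc] at h1
        simp only [F, Finset.card_eq_zero, hT, if_false]
        calc _ ≤ (Fintype.card {g : {a // a ∉ T} → Fin s // Function.Surjective g} : ℝ) * x ^ N := by
              gcongr; exact_mod_cast key T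
          _ = (Fintype.card {g : {a // a ∉ T} → Fin s // Function.Surjective g} : ℝ) *
              x ^ (N - T.card) * x ^ T.card := by
              rw [mul_assoc, ← pow_add, Nat.sub_add_cancel hle]
          _ ≤ _ := by
              have h2 := mul_le_mul_of_nonneg_right h1 (pow_nonneg hx.le T.card)
              refine le_trans (le_of_eq ?_) h2
              congr!
    rw [hcount]
    push_cast
    rw [Finset.sum_mul]
    refine (Finset.sum_le_sum fun T _ => hterm T).trans ?_
    rw [← Finset.powerset_univ, Finset.sum_powerset_apply_card F, Finset.card_univ, ← hN,
      Finset.sum_range_succ']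
    simp only [F, if_true, smul_zero, add_zero, Nat.succ_ne_zero, if_false]
    have hsum : ∑ t ∈ Finset.range N, x ^ (t + 1) / (t + 1).factorial ≤ Real.exp x - 1 := by
      have := Real.sum_le_exp_of_nonneg hx.le (N + 1)
      rw [Finset.sum_range_succ'] at this
      simp at this
      linarith
    calc _ = (N.factorial : ℝ) * (Real.exp x - 1) ^ s *
          ∑ t ∈ Finset.range N, x ^ (t + 1) / (t + 1).factorial := by
          rw [Finset.mul_sum]
          refine Finset.sum_congr rfl fun t ht => ?_
          have := Nat.choose_mul_factorial_mul_factorial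
            (Nat.succ_le_of_lt (Finset.mem_range.1 ht))
          rw [← this]
          simp only [Nat.succ_eq_add_one]
          push_cast
          have : ((t + 1).factorial : ℝ) ≠ 0 := by positivity
          field_simp
          simp only [nsmul_eq_mul]
          ring
      _ ≤ _ := by
          rw [pow_succ, ← mul_assoc]
          gcongr

lemma card_surjective_mul_pow_le {α β : Type} [Fintype α] [Fintype β] {x : ℝ} (hx : 0 < x) :
    (Fintype.card {g : α → β // Function.Surjective g} : ℝ) * x ^ Fintype.card α ≤
      (Fintype.card α).factorial * (Real.exp x - 1) ^ Fintype.card β := by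
  have e := Fintype.equivFin β
  rw [Fintype.card_congr ((Equiv.arrowCongr (Equiv.refl α) e).subtypeEquiv
    (q := fun g : α → Fin (Fintype.card β) => Function.Surjective g) fun g => by simp [Equiv.arrowCongr])]
  exact card_surjective_fin_mul_pow_le _ hx α

lemma factorial_le_mul_pow {N : ℕ} (hN : 1 ≤ N) :
    (N.factorial : ℝ) ≤ Real.exp 1 * N * (N ^ N * Real.exp (-N)) := by
  induction N, hN using Nat.le_induction with
  | base => rw [mul_comm (_ * _), mul_assoc]; simp [← Real.exp_add]
  | succ N hN ih =>
    have hN0 : (0 : ℝ) < N := by exact_mod_cast hN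
    have h1 : Real.exp 1 ≤ ((N + 1 : ℝ) / N) ^ (N + 1) := by
      rw [← Real.log_le_log_iff (by positivity) (by positivity), Real.log_exp, Real.log_pow]
      have := Real.one_sub_inv_le_log_of_pos (x := (N + 1 : ℝ) / N) (by positivity)
      have e : 1 - ((N + 1 : ℝ) / N)⁻¹ = 1 / (N + 1) := by field_simp; ring
      rw [e, div_le_iff₀ (by positivity)] at this
      push_cast
      linarith
    rw [Nat.factorial_succ]
    push_cast
    calc ((N : ℝ) + 1) * N.factorial
        ≤ (N + 1) * (Real.exp 1 * N * (N ^ N * Real.exp (-N))) := by gcongr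
      _ = (N + 1) * (N ^ (N + 1) * Real.exp (-N)) * Real.exp 1 := by ring
      _ ≤ (N + 1) * (N ^ (N + 1) * Real.exp (-N)) * ((N + 1 : ℝ) / N) ^ (N + 1) := by gcongr
      _ = (N + 1) * (N + 1) ^ (N + 1) * Real.exp (-N) := by
          rw [div_pow]; field_simp
      _ = _ := by
          rw [neg_add, Real.exp_add, Real.exp_neg 1]
          field_simp

lemma choose_mul_pow_mul_pow_le_one {n s : ℕ} (hs : s ≤ n) {a : ℝ} (h0 : 0 ≤ a) (h1 : a ≤ 1) :
    (n.choose s : ℝ) * (a ^ s * (1 - a) ^ (n - s)) ≤ 1 := by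
  have := add_pow a (1 - a) n
  rw [add_sub_cancel, one_pow] at this
  refine le_of_le_of_eq ?_ this.symm
  rw [mul_comm]
  have h1' : 0 ≤ 1 - a := by linarith
  exact Finset.single_le_sum (f := fun m => a ^ m * (1 - a) ^ (n - m) * (n.choose m : ℝ))
    (fun i _ => by positivity) (Finset.mem_range.2 (Nat.lt_succ_of_le hs))

end Surjections

section ClosedStrConn

variable {n k : ℕ} {f : Fin n × Fin k → Fin n} {S T : Set (Fin n)}

/-- A closed strongly connected set of vertices. -/
def IsClosedStrConn (f : Fin n × Fin k → Fin n) (S : Set (Fin n)) : Prop :=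
  IsClosedSet f S ∧ IsStrConn f S

lemma IsClosedSet.mem_of_reaches (hS : IsClosedSet f S) {u v : Fin n} (hu : u ∈ S)
    (h : Reaches f u v) : v ∈ S := by
  induction h with
  | refl => exact hu
  | tail _ h ih =>
    obtain ⟨i, rfl⟩ := h
    exact hS _ ih i

lemma IsClosedStrConn.exists_arc (hk : 1 ≤ k) (hS : IsClosedStrConn f S) {v : Fin n}
    (hv : v ∈ S) : ∃ u ∈ S, ∃ i, f (u, i) = v := by
  have hw := hS.1 v hv ⟨0, hk⟩
  rcases Relation.ReflTransGen.cases_tail (hS.2.2 _ hw v hv) with h | ⟨c, hc, i, hi⟩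
  · exact ⟨v, hv, _, h.symm⟩
  · exact ⟨c, hS.1.mem_of_reaches hw hc, i, hi⟩

lemma IsClosedStrConn.eq_of_mem (hS : IsClosedStrConn f S) (hT : IsClosedStrConn f T) {v : Fin n}
    (hvS : v ∈ S) (hvT : v ∈ T) : S = T := by
  ext u
  exact ⟨fun h => hT.1.mem_of_reaches hvT (hS.2.2 _ hvS _ h),
    fun h => hS.1.mem_of_reaches hvS (hT.2.2 _ hvT _ h)⟩

lemma exists_isClosedStrConn [Nonempty (Fin n)] (f : Fin n × Fin k → Fin n) :
    ∃ S, IsClosedStrConn f S := by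
  obtain ⟨v, hv⟩ := Finite.exists_min fun v => {u | Reaches f v u}.ncard
  refine ⟨{u | Reaches f v u}, fun u hu i => hu.tail ⟨i, rfl⟩, ⟨v, .refl⟩, fun u hu w hw => ?_⟩
  have hsub : {w | Reaches f u w} ⊆ {w | Reaches f v w} := fun w hw => hu.trans hw
  have := Set.eq_of_subset_of_ncard_le hsub (hv u)
  exact (Set.ext_iff.1 this w).2 hw

lemma IsClosedStrConn.eq_of_half_lt (hS : IsClosedStrConn f S) (hT : IsClosedStrConn f T)
    (h : n < 2 * S.ncard) (hST : S.ncard ≤ T.ncard) : S = T := by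
  have : ¬ Disjoint S T := by
    intro hd
    have h1 := Set.ncard_union_eq hd
    have h2 := Set.ncard_le_card (S ∪ T)
    simp only [Nat.card_eq_fintype_card, Fintype.card_fin] at h2
    omega
  obtain ⟨v, hvS, hvT⟩ := Set.not_disjoint_iff.1 this
  exact hS.eq_of_mem hT hvS hvT

lemma IsClosedStrConn.isGiant_iff (hS : IsClosedStrConn f S) (h : n < 2 * S.ncard)
    (G : Set (Fin n)) : IsGiant f G ↔ G = S := by
  constructor
  · rintro ⟨h1, h2, h3, -⟩
    exact (hS.eq_of_half_lt ⟨h1, h2⟩ h (h3 S hS.1 hS.2)).symm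
  · rintro rfl
    refine ⟨hS.1, hS.2, fun T h1 h2 => ?_, fun T h1 h2 h3 => ?_⟩
    · by_contra! hlt
      exact hlt.ne (congrArg Set.ncard (hS.eq_of_half_lt ⟨h1, h2⟩ h hlt.le))
    · rw [← hS.eq_of_half_lt ⟨h1, h2⟩ h h3.ge]
      obtain ⟨v, hv, hmin⟩ := Set.exists_min_image G id (Set.toFinite G) hS.2.1
      exact ⟨v, hv, hmin⟩

end ClosedStrConn

section FirstMoment

lemma prob_nonneg (n k : ℕ) (P : (Fin n × Fin k → Fin n) → Prop) : 0 ≤ prob n k P := by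
  unfold prob; positivity

lemma prob_mono {n k : ℕ} {P Q : (Fin n × Fin k → Fin n) → Prop} (h : ∀ f, P f → Q f) :
    prob n k P ≤ prob n k Q := by
  unfold prob
  gcongr with f
  exact h f

lemma prob_exists_le_sum {n k : ℕ} {ι : Type*} (s : Finset ι)
    (P : ι → (Fin n × Fin k → Fin n) → Prop) :
    prob n k (fun f => ∃ i ∈ s, P i f) ≤ ∑ i ∈ s, prob n k (P i) := by
  unfold prob
  rw [← Finset.sum_div]
  gcongr
  have h : ∑ i ∈ s, ((Finset.univ.filter (P i)).card : ℝ) =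
      (∑ i ∈ s, (Finset.univ.filter (P i)).card : ℕ) := by push_cast; rfl
  rw [h, Nat.cast_le]
  refine le_trans (Finset.card_le_card fun f hf => ?_) Finset.card_biUnion_le
  simpa using hf

lemma prob_isClosedStrConn_le {n k : ℕ} (hn : 1 ≤ n) (hk : 1 ≤ k) (S : Finset (Fin n)) :
    prob n k (fun f => IsClosedStrConn f S) ≤
      (Fintype.card {g : S × Fin k → S // Function.Surjective g} : ℝ) / (n : ℝ) ^ (k * S.card) := by
  have hcard : (Finset.univ.filter fun f : Fin n × Fin k → Fin n => IsClosedStrConn f S).card ≤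
      Fintype.card {g : S × Fin k → S // Function.Surjective g} *
        Fintype.card ({p : Fin n × Fin k // p.1 ∉ S} → Fin n) := by
    rw [← Fintype.card_subtype, ← Fintype.card_prod]
    refine Fintype.card_le_of_injective (fun f => (⟨fun p => ⟨f.1 (p.1, p.2),
      f.2.1 p.1 p.1.2 p.2⟩, fun v => ?_⟩, fun p => f.1 p.1)) fun f g h => ?_
    · obtain ⟨u, hu, i, hi⟩ := f.2.exists_arc hk v.2
      exact ⟨(⟨u, hu⟩, i), Subtype.ext hi⟩
    · ext ⟨v, i⟩ : 2
      by_cases hv : v ∈ S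
      · exact congrArg Subtype.val (congrFun (congrArg Subtype.val (congrArg Prod.fst h))
          ((⟨v, hv⟩ : S), i))
      · exact congrFun (congrArg Prod.snd h) (⟨(v, i), hv⟩ : {p : Fin n × Fin k // p.1 ∉ S})
  have hS : S.card ≤ n := by simpa using Finset.card_le_univ S
  have hc : Fintype.card {p : Fin n × Fin k // p.1 ∉ S} + k * S.card = n * k := by
    have e : Fintype.card {p : Fin n × Fin k // p.1 ∉ S} =
        Fintype.card ({v : Fin n // v ∉ S} × Fin k) :=
      Fintype.card_congr
        { toFun := fun p => (⟨p.1.1, p.2⟩, p.1.2)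
          invFun := fun p => ⟨(p.1, p.2), p.1.2⟩
          left_inv := fun _ => rfl
          right_inv := fun _ => rfl }
    rw [e, Fintype.card_prod, Fintype.card_subtype_compl, Fintype.card_coe]
    simp only [Fintype.card_fin]
    rw [mul_comm k, ← add_mul, Nat.sub_add_cancel hS]
  unfold prob
  have hn0 : (0 : ℝ) < n := by exact_mod_cast hn
  rw [div_le_div_iff₀ (by simp; positivity) (by positivity)]
  calc _ ≤ ((Fintype.card {g : S × Fin k → S // Function.Surjective g} *
        Fintype.card ({p : Fin n × Fin k // p.1 ∉ S} → Fin n) : ℕ) : ℝ) *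
        (n : ℝ) ^ (k * S.card) := by gcongr
    _ = _ := by
      simp only [Fintype.card_fun, Fintype.card_fin, Fintype.card_prod (Fin n)]
      rw [← hc]
      push_cast
      ring

lemma sum_prob_isClosedStrConn_le_pow {n k s : ℕ} (hn : 1 ≤ n) (hk : 2 ≤ k) (hs : 1 ≤ s) :
    ∑ S ∈ Finset.powersetCard s (Finset.univ : Finset (Fin n)),
      prob n k (fun f => IsClosedStrConn f S) ≤ (s : ℝ) ^ (k * s) / n := by
  have hn1 : (1 : ℝ) ≤ n := by exact_mod_cast hn
  have h : ∀ S ∈ Finset.powersetCard s (Finset.univ : Finset (Fin n)),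
      prob n k (fun f => IsClosedStrConn f S) ≤ (s : ℝ) ^ (k * s) / (n : ℝ) ^ (k * s) := by
    intro S hS
    have hS := (Finset.mem_powersetCard.1 hS).2
    refine (prob_isClosedStrConn_le hn (by omega) S).trans ?_
    rw [hS]
    gcongr
    have := Fintype.card_subtype_le (fun g : S × Fin k → S => Function.Surjective g)
    simp only [Fintype.card_fun, Fintype.card_prod, Fintype.card_coe, hS, Fintype.card_fin] at this
    rw [mul_comm k s]
    exact_mod_cast this
  refine (Finset.sum_le_sum h).trans ?_
  rw [Finset.sum_const, Finset.card_powersetCard, Finset.card_univ, Fintype.card_fin, nsmul_eq_mul]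
  have h1 : (n.choose s : ℝ) ≤ (n : ℝ) ^ s := by exact_mod_cast Nat.choose_le_pow n s
  have h2 : (n : ℝ) ^ (s + 1) ≤ (n : ℝ) ^ (k * s) := pow_le_pow_right₀ hn1 (by nlinarith)
  calc (n.choose s : ℝ) * ((s : ℝ) ^ (k * s) / (n : ℝ) ^ (k * s))
      ≤ (n : ℝ) ^ s * ((s : ℝ) ^ (k * s) / (n : ℝ) ^ (s + 1)) := by gcongr
    _ = _ := by
      have : (n : ℝ) ≠ 0 := by positivity
      rw [pow_succ]
      field_simp

lemma sum_prob_isClosedStrConn_le_exp {n k s : ℕ} (hk : 2 ≤ k) (hs : 1 ≤ s) (hsn : s ≤ n)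
    {ν : ℝ} (h0 : 0 < ν) (h1 : ν < 1) (hν : Real.log (1 - ν) = -(k * ν)) :
    ∑ S ∈ Finset.powersetCard s (Finset.univ : Finset (Fin n)),
      prob n k (fun f => IsClosedStrConn f S) ≤
      Real.exp 1 * (k * s) * Real.exp (s * rate k ν (s / n)) := by
  have hn0 : (0 : ℝ) < n := by exact_mod_cast (by omega : 0 < n)
  have hs0 : (0 : ℝ) < s := by exact_mod_cast hs
  have hk0 : (0 : ℝ) < k := by exact_mod_cast (by omega : 0 < k)
  have h1' : 0 < 1 - ν := by linarith
  set B : ℝ := Real.exp 1 * (k * s) * Real.exp (-(k * s)) * (s / (n * ν)) ^ (k * s) *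
    (ν / (1 - ν)) ^ s with hB
  have h : ∀ S ∈ Finset.powersetCard s (Finset.univ : Finset (Fin n)),
      prob n k (fun f => IsClosedStrConn f S) ≤ B := by
    intro S hS
    have hS := (Finset.mem_powersetCard.1 hS).2
    refine (prob_isClosedStrConn_le (by omega) (by omega) S).trans ?_
    have hsurj := card_surjective_mul_pow_le (α := S × Fin k) (β := S) (x := k * ν) (by positivity)
    have hexp : Real.exp (k * ν) - 1 = ν / (1 - ν) := by
      rw [← neg_neg (k * ν), ← hν, Real.exp_neg, Real.exp_log h1']
      field_simp; ring
    have hfac := factorial_le_mul_pow (N := k * s) (Nat.mul_pos (by omega) hs)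
    simp only [Fintype.card_prod, Fintype.card_coe, hS, Fintype.card_fin, hexp] at hsurj
    rw [mul_comm s k] at hsurj
    rw [hS]
    rw [← le_div_iff₀ (by positivity)] at hsurj
    calc _ ≤ ((k * s).factorial * (ν / (1 - ν)) ^ s / (k * ν) ^ (k * s)) / (n : ℝ) ^ (k * s) := by
          refine div_le_div_of_nonneg_right (le_trans (le_of_eq ?_) hsurj) (by positivity)
          congr!
      _ ≤ ((Real.exp 1 * (k * s : ℕ) * ((k * s : ℕ) ^ (k * s) * Real.exp (-(k * s : ℕ)))) *
          (ν / (1 - ν)) ^ s / (k * ν) ^ (k * s)) / (n : ℝ) ^ (k * s) := by gcongr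
      _ = B := by
          rw [hB]
          push_cast
          simp only [mul_pow, div_pow]
          field_simp
  refine (Finset.sum_le_sum h).trans ?_
  rw [Finset.sum_const, Finset.card_powersetCard, Finset.card_univ, Fintype.card_fin, nsmul_eq_mul]
  set a : ℝ := s / n with ha
  have ha0 : 0 < a := by positivity
  have ha1 : a ≤ 1 := by rw [ha, div_le_one hn0]; exact_mod_cast hsn
  have hch := choose_mul_pow_mul_pow_le_one hsn ha0.le ha1
  have hneg : Real.exp (n * Real.negMulLog (1 - a)) * (1 - a) ^ (n - s) = 1 := by
    rcases ha1.eq_or_lt with h | h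
    · have : s = n := by
        rw [ha, div_eq_one_iff_eq hn0.ne'] at h; exact_mod_cast h
      simp [h, this]
    · have e : (n : ℝ) * Real.negMulLog (1 - a) = -((n - s : ℕ) * Real.log (1 - a)) := by
        rw [Nat.cast_sub hsn, Real.negMulLog, ha]
        field_simp
      rw [e, Real.exp_neg, Real.exp_nat_mul, Real.exp_log (by linarith)]
      have : 0 < 1 - a := by linarith
      field_simp
  have hrate : Real.exp (s * rate k ν a) * a ^ s = Real.exp (n * Real.negMulLog (1 - a)) *
      (a / ν) ^ (k * s) * Real.exp (-(k * s)) * (ν / (1 - ν)) ^ s := by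
    have e : s * rate k ν a = -(s * Real.log a) + n * Real.negMulLog (1 - a) +
        (k * s : ℕ) * Real.log (a / ν) + -(k * s) + s * Real.log (ν / (1 - ν)) := by
      rw [rate, Real.log_div ha0.ne' h0.ne', Real.log_div h0.ne' h1'.ne']
      have : s * (Real.negMulLog (1 - a) / a) = n * Real.negMulLog (1 - a) := by
        rw [ha]; field_simp
      push_cast
      linear_combination this
    rw [e]
    simp only [Real.exp_add, Real.exp_nat_mul]
    rw [Real.exp_neg (s * Real.log a), Real.exp_nat_mul, Real.exp_log ha0,
      Real.exp_log (by positivity), Real.exp_log (by positivity)]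
    field_simp
  have hBa : B * a ^ s = Real.exp 1 * (k * s) * Real.exp (s * rate k ν a) *
      (a ^ s * (a ^ s * (1 - a) ^ (n - s))) := by
    rw [hB, show (s : ℝ) / (n * ν) = a / ν by rw [ha]; field_simp]
    calc _ = Real.exp 1 * (k * s) * a ^ s * (1 * (a / ν) ^ (k * s) * Real.exp (-(k * s)) *
          (ν / (1 - ν)) ^ s) := by ring
      _ = _ := by
        linear_combination (-(Real.exp 1 * (k * s) * a ^ s * (1 - a) ^ (n - s))) * hrate -
          Real.exp 1 * (k * s) * a ^ s * ((a / ν) ^ (k * s) * Real.exp (-(k * s)) *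
          (ν / (1 - ν)) ^ s) * hneg
  have hBe : B = Real.exp 1 * (k * s) * Real.exp (s * rate k ν a) *
      (a ^ s * (1 - a) ^ (n - s)) := by
    have : a ^ s ≠ 0 := by positivity
    apply mul_right_cancel₀ this
    rw [hBa]; ring
  rw [hBe]
  calc _ = Real.exp 1 * (k * s) * Real.exp (s * rate k ν a) *
        (n.choose s * (a ^ s * (1 - a) ^ (n - s))) := by ring
    _ ≤ Real.exp 1 * (k * s) * Real.exp (s * rate k ν a) * 1 := by gcongr
    _ = _ := mul_one _

lemma tendsto_prob_exists_isClosedStrConn {k : ℕ} (hk : 2 ≤ k) {ν ε : ℝ}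
    (hν : Real.log (1 - ν) = -(k * ν)) (hε : 0 < ε) (h0 : 0 < ν - ε) (h1 : ν + ε < 1) :
    Tendsto (fun n : ℕ => prob n k fun f => ∃ S : Finset (Fin n),
      IsClosedStrConn f S ∧ ε ≤ |(S.card : ℝ) / n - ν|) atTop (nhds 0) := by
  obtain ⟨c, hc, hrate⟩ := exists_rate_le hν hε h0 h1
  let F : ℕ → ℕ → ℝ := fun n s => if 1 ≤ s ∧ s ≤ n ∧ ε ≤ |(s : ℝ) / n - ν| then
    ∑ S ∈ Finset.powersetCard s (Finset.univ : Finset (Fin n)),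
      prob n k (fun f => IsClosedStrConn f S) else 0
  have hF0 : ∀ n s, 0 ≤ F n s := by
    intro n s
    simp only [F]
    split_ifs
    · exact Finset.sum_nonneg fun _ _ => prob_nonneg _ _ _
    · exact le_rfl
  have hbound : ∀ n s, ‖F n s‖ ≤ Real.exp 1 * k * (s ^ 1 * Real.exp (-c * s)) := by
    intro n s
    rw [Real.norm_of_nonneg (hF0 n s)]
    simp only [F]
    split_ifs with h
    · obtain ⟨hs, hsn, hb⟩ := h
      refine (sum_prob_isClosedStrConn_le_exp hk hs hsn (by linarith) (by linarith) hν).trans ?_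
      have hn0 : (0 : ℝ) < n := by exact_mod_cast (by omega : 0 < n)
      have hs0 : (0 : ℝ) < s := by exact_mod_cast hs
      have := hrate (s / n) (by positivity)
        (by rw [div_le_one hn0]; exact_mod_cast hsn) hb
      rw [pow_one, ← mul_assoc, ← mul_assoc]
      refine mul_le_mul_of_nonneg_left (Real.exp_le_exp.2 ?_) (by positivity)
      nlinarith
    · positivity
  have hlim : Tendsto (fun n => ∑' s, F n s) atTop (nhds (∑' _ : ℕ, (0 : ℝ))) := by
    refine tendsto_tsum_of_dominated_convergence
      (bound := fun s : ℕ => Real.exp 1 * k * (s ^ 1 * Real.exp (-c * s))) ?_ ?_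
      (Eventually.of_forall hbound)
    · exact (Real.summable_pow_mul_exp_neg_nat_mul 1 hc).mul_left _
    · intro s
      refine squeeze_zero' (Eventually.of_forall fun n => hF0 n s) (g := fun n : ℕ =>
        (s : ℝ) ^ (k * s) / n) ?_ (tendsto_const_div_atTop_nhds_zero_nat _)
      filter_upwards [eventually_ge_atTop 1] with n hn
      simp only [F]
      split_ifs with h
      · exact sum_prob_isClosedStrConn_le_pow hn hk h.1
      · positivity
  rw [tsum_zero] at hlim
  refine squeeze_zero (fun n => prob_nonneg _ _ _) (fun n => ?_) hlim
  have hsupp : ∀ s ∉ Finset.range (n + 1), F n s = 0 := by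
    intro s hs
    simp only [F]
    rw [if_neg]
    simp at hs
    omega
  rw [tsum_eq_sum hsupp]
  calc _ ≤ prob n k (fun f => ∃ s ∈ Finset.range (n + 1), (1 ≤ s ∧ s ≤ n ∧
        ε ≤ |(s : ℝ) / n - ν|) ∧ ∃ S ∈ Finset.powersetCard s (Finset.univ : Finset (Fin n)),
        IsClosedStrConn f S) := by
        refine prob_mono fun f ⟨S, hS, hb⟩ => ?_
        have hSn : S.card ≤ n := by simpa using Finset.card_le_univ S
        have hS1 : 1 ≤ S.card := Finset.card_pos.2 (by simpa using hS.2.1)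
        exact ⟨S.card, by simp; omega, ⟨hS1, hSn, hb⟩, S, by simp, hS⟩
    _ ≤ _ := by
        refine (prob_exists_le_sum _ _).trans (Finset.sum_le_sum fun s _ => ?_)
        simp only [F]
        split_ifs with h
        · exact (prob_mono fun f hf => hf.2).trans (prob_exists_le_sum _ _)
        · simp [prob, h]

end FirstMoment

section MethodOfMoments

/-- The truncated inclusion-exclusion sum for the indicator of `x = m`. -/
noncomputable def bonferroniSum (m x J : ℕ) : ℝ :=
  ∑ i ∈ Finset.range (J + 1), (-1 : ℝ) ^ i * ((m + i).choose m * x.choose (m + i))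

lemma bonferroniSum_of_lt {m x : ℕ} (h : m < x) (J : ℕ) :
    bonferroniSum m x J = (-1) ^ J * (x.choose m * (x - m - 1).choose J) := by
  obtain ⟨d, rfl⟩ := Nat.exists_eq_add_of_lt h
  have key := Int.alternating_sum_range_choose_eq_choose (n := d) (m := J)
  have e : ∀ i, (m + i).choose m * (m + d + 1).choose (m + i) =
      (m + d + 1).choose m * (d + 1).choose i := by
    intro i
    rw [mul_comm, Nat.choose_mul (by omega), show m + d + 1 - m = d + 1 by omega,
      Nat.add_sub_cancel_left]
  have e' : ∀ i, ((m + i).choose m * (m + d + 1).choose (m + i) : ℝ) =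
      (m + d + 1).choose m * (d + 1).choose i := fun i => by exact_mod_cast e i
  have key' : ∑ i ∈ Finset.range (J + 1), (-1 : ℝ) ^ i * (d + 1).choose i =
      (-1) ^ J * d.choose J := by
    have := congrArg (Int.cast : ℤ → ℝ) key
    push_cast at this
    exact this
  simp only [bonferroniSum, e']
  rw [show m + d + 1 - m - 1 = d by omega, mul_left_comm, ← key', Finset.mul_sum]
  exact Finset.sum_congr rfl fun i _ => by ring

lemma bonferroniSum_self (m J : ℕ) : bonferroniSum m m J = 1 := by
  rw [bonferroniSum, Finset.sum_range_succ', Finset.sum_eq_zero]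
  · simp
  · intro i _
    simp [Nat.choose_eq_zero_of_lt (show m < m + (i + 1) by omega)]

lemma bonferroniSum_of_gt {m x : ℕ} (h : x < m) (J : ℕ) : bonferroniSum m x J = 0 :=
  Finset.sum_eq_zero fun i _ => by
    simp [Nat.choose_eq_zero_of_lt (show x < m + i by omega)]

lemma indicator_le_bonferroniSum (m x J : ℕ) :
    (if x = m then 1 else 0 : ℝ) ≤ bonferroniSum m x (2 * J) := by
  rcases lt_trichotomy x m with h | rfl | h
  · simp [bonferroniSum_of_gt h, h.ne]
  · simp [bonferroniSum_self]
  · rw [bonferroniSum_of_lt h, if_neg h.ne', pow_mul]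
    simp only [even_two, Even.neg_pow, one_pow, one_mul]
    positivity

lemma bonferroniSum_le_indicator (m x J : ℕ) :
    bonferroniSum m x (2 * J + 1) ≤ (if x = m then 1 else 0 : ℝ) := by
  rcases lt_trichotomy x m with h | rfl | h
  · simp [bonferroniSum_of_gt h, h.ne]
  · simp [bonferroniSum_self]
  · rw [bonferroniSum_of_lt h, if_neg h.ne', pow_succ, pow_mul]
    simp only [even_two, Even.neg_pow, one_pow, one_mul, neg_mul, Left.neg_nonpos_iff]
    positivity

/-- Convergence of binomial moments to those of a Poisson law implies convergence of the
point probabilities. -/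
lemma tendsto_poisson_of_binomial_moments {ι : Type*} {l : Filter ι} {Ω : ι → Type*}
    [∀ i, Fintype (Ω i)] (X : ∀ i, Ω i → ℕ) (r : ℝ)
    (h : ∀ j, Tendsto (fun i => (∑ ω, ((X i ω).choose j : ℝ)) / Fintype.card (Ω i)) l
      (nhds (r ^ j / j.factorial))) (m : ℕ) :
    Tendsto (fun i => ((Finset.univ.filter fun ω => X i ω = m).card : ℝ) / Fintype.card (Ω i)) l
      (nhds (Real.exp (-r) * r ^ m / m.factorial)) := by
  let A : ℕ → ℝ := fun J => ∑ i ∈ Finset.range (J + 1),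
    (-1 : ℝ) ^ i * ((m + i).choose m * (r ^ (m + i) / (m + i).factorial))
  have hB : ∀ J, Tendsto (fun i => (∑ ω, bonferroniSum m (X i ω) J) / Fintype.card (Ω i)) l
      (nhds (A J)) := by
    intro J
    have e : ∀ i, (∑ ω, bonferroniSum m (X i ω) J) / Fintype.card (Ω i) =
        ∑ t ∈ Finset.range (J + 1), (-1 : ℝ) ^ t * ((m + t).choose m *
          ((∑ ω, ((X i ω).choose (m + t) : ℝ)) / Fintype.card (Ω i))) := by
      intro i
      simp only [bonferroniSum]
      rw [Finset.sum_comm, Finset.sum_div]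
      refine Finset.sum_congr rfl fun t _ => ?_
      rw [← Finset.mul_sum, ← Finset.mul_sum]
      ring
    simp only [e]
    exact tendsto_finsetSum _ fun t _ => ((h _).const_mul _).const_mul _
  have hA : Tendsto A atTop (nhds (Real.exp (-r) * r ^ m / m.factorial)) := by
    have hs := (NormedSpace.expSeries_div_hasSum_exp (-r)).tendsto_sum_nat
    have := ((tendsto_add_atTop_iff_nat 1).2 hs).mul_const (r ^ m / m.factorial)
    rw [← mul_div_assoc, ← Real.exp_eq_exp_ℝ] at this
    refine this.congr fun J => ?_
    rw [Finset.sum_mul]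
    refine Finset.sum_congr rfl fun t _ => ?_
    rw [Nat.cast_choose ℝ (Nat.le_add_right m t), Nat.add_sub_cancel_left, neg_pow]
    have := Nat.factorial_ne_zero
    have h1 : ((m + t).factorial : ℝ) ≠ 0 := by exact_mod_cast this _
    field_simp
    ring
  have hP : ∀ i, ((Finset.univ.filter fun ω => X i ω = m).card : ℝ) / Fintype.card (Ω i) =
      (∑ ω, if X i ω = m then 1 else 0 : ℝ) / Fintype.card (Ω i) := by
    intro i
    rw [Finset.sum_boole]
  rw [tendsto_order]
  constructor
  · intro a ha
    have h2 : Tendsto (fun J : ℕ => 2 * J + 1) atTop atTop :=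
      tendsto_atTop_mono (fun J => by simp; omega) tendsto_id
    obtain ⟨J, hJ⟩ := ((hA.comp h2).eventually_const_lt ha).exists
    filter_upwards [(hB _).eventually_const_lt hJ] with i hi
    refine hi.trans_le ?_
    rw [hP]
    gcongr
    exact bonferroniSum_le_indicator _ _ _
  · intro a ha
    have h2 : Tendsto (fun J : ℕ => 2 * J) atTop atTop :=
      tendsto_atTop_mono (fun J => by simp; omega) tendsto_id
    obtain ⟨J, hJ⟩ := ((hA.comp h2).eventually_lt_const ha).exists
    filter_upwards [(hB _).eventually_lt_const hJ] with i hi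
    refine lt_of_le_of_lt ?_ hi
    rw [hP]
    gcongr
    exact indicator_le_bonferroniSum _ _ _

end MethodOfMoments

section Tuples

lemma card_injective_tuples {β : Type*} [Fintype β] (Y : Finset β) (j : ℕ) :
    (Finset.univ.filter fun D : Fin j → β => (∀ a, D a ∈ Y) ∧ Function.Injective D).card =
      Y.card.descFactorial j := by
  rw [← Fintype.card_subtype]
  have := Fintype.card_embedding_eq (α := Fin j) (β := Y)
  rw [Fintype.card_coe, Fintype.card_fin] at this
  rw [← this]
  exact Fintype.card_congr
    { toFun := fun D => ⟨fun a => ⟨D.1 a, D.2.1 a⟩, fun a b h => D.2.2 (congrArg Subtype.val h)⟩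
      invFun := fun D => ⟨fun a => D a, fun a => (D a).2,
        fun a b h => D.injective (Subtype.ext h)⟩
      left_inv := fun _ => rfl
      right_inv := fun _ => rfl }

lemma card_tuples_of_card_fiber {α β : Type*} [Fintype α] [Fintype β] (X : Finset α) (q : α → β)
    {p : ℕ} (hp : 1 ≤ p) (hX : ∀ c ∈ X, (X.filter fun c' => q c' = q c).card = p) (j : ℕ) :
    (Finset.univ.filter fun C : Fin j → α =>
      (∀ a, C a ∈ X) ∧ Function.Injective fun a => q (C a)).card =
      p ^ j * (X.card / p).descFactorial j := by
  have hY : ∀ b ∈ X.image q, (X.filter fun c => q c = b).card = p := by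
    intro b hb
    obtain ⟨c, hc, rfl⟩ := Finset.mem_image.1 hb
    exact hX c hc
  have hXY : X.card / p = (X.image q).card := by
    rw [Finset.card_eq_sum_card_image q X, Finset.sum_congr rfl hY, Finset.sum_const, smul_eq_mul,
      Nat.mul_div_cancel _ hp]
  rw [hXY, ← card_injective_tuples, mul_comm, ← smul_eq_mul, ← Finset.sum_const,
    Finset.card_eq_sum_card_fiberwise (f := fun C a => q (C a))
      (t := Finset.univ.filter fun D : Fin j → β =>
        (∀ a, D a ∈ X.image q) ∧ Function.Injective D)]
  · refine Finset.sum_congr rfl fun D hD => ?_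
    simp only [Finset.mem_filter, Finset.mem_univ, true_and] at hD
    have : (Finset.filter (fun C => (fun a => q (C a)) = D) (Finset.univ.filter fun C : Fin j → α =>
        (∀ a, C a ∈ X) ∧ Function.Injective fun a => q (C a))) =
        Fintype.piFinset fun a => X.filter fun c => q c = D a := by
      ext C
      simp only [Finset.mem_filter, Finset.mem_univ, true_and, Fintype.mem_piFinset]
      constructor
      · rintro ⟨h, rfl⟩ a
        exact ⟨h.1 a, rfl⟩
      · intro h
        have e : (fun a => q (C a)) = D := funext fun a => (h a).2
        exact ⟨⟨fun a => (h a).1, e ▸ hD.2⟩, e⟩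
    rw [this, Fintype.card_piFinset, Finset.prod_congr rfl fun a _ => hY _ (hD.1 a)]
    simp
  · intro C hC
    simp only [Finset.coe_filter, Finset.mem_univ, true_and, Set.mem_ofPred_eq] at hC ⊢
    exact ⟨fun a => Finset.mem_image_of_mem q (hC.1 a), hC.2⟩

end Tuples

section Rotations

variable {V : Type*} {p : ℕ} [NeZero p]

/-- The set of rotations of a cyclic sequence. -/
noncomputable def rotations (c : ZMod p → V) : Finset (ZMod p → V) :=
  Finset.univ.image fun t i => c (i + t)

lemma mem_rotations {c c' : ZMod p → V} : c' ∈ rotations c ↔ ∃ t, ∀ i, c' i = c (i + t) := by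
  simp only [rotations, Finset.mem_image, Finset.mem_univ, true_and, funext_iff, eq_comm]

lemma rotations_eq_iff {c c' : ZMod p → V} : rotations c' = rotations c ↔ c' ∈ rotations c := by
  constructor
  · intro h
    rw [← h]
    exact mem_rotations.2 ⟨0, by simp⟩
  · intro h
    obtain ⟨t, ht⟩ := mem_rotations.1 h
    ext d
    simp only [mem_rotations]
    constructor
    · rintro ⟨s, hs⟩
      exact ⟨s + t, fun i => by rw [hs, ht, add_assoc]⟩
    · rintro ⟨s, hs⟩
      exact ⟨s - t, fun i => by rw [hs, ht]; congr 1; ring⟩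

lemma card_rotations {c : ZMod p → V} (hc : Function.Injective c) : (rotations c).card = p := by
  rw [rotations, Finset.card_image_of_injective, Finset.card_univ, ZMod.card]
  intro s t h
  simpa using hc (congrFun h 0)

end Rotations

section CycleTuples

variable {n k : ℕ} {p : ℕ} [NeZero p]

/-- The rooted directed cycles of length `p` with all vertices in `A`. -/
noncomputable def rootedCycles (f : Fin n × Fin k → Fin n) (A : Set (Fin n)) (p : ℕ) [NeZero p] :
    Finset (ZMod p → Fin n) :=
  Finset.univ.filter fun c => Function.Injective c ∧ (∀ j, c j ∈ A) ∧
    ∀ j, ∃ i : Fin k, f (c j, i) = c (j + 1)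

lemma numCycles_eq (f : Fin n × Fin k → Fin n) (A : Set (Fin n)) :
    numCycles f A p = (rootedCycles f A p).card / p := by
  cases p with
  | zero => exact absurd rfl (NeZero.ne 0)
  | succ p =>
    rw [numCycles, rootedCycles]

/-- The static part of being a tuple of pairwise distinct cycles inside `A`. -/
def IsCycleTuple {j : ℕ} (A : Set (Fin n)) (C : Fin j → ZMod p → Fin n) : Prop :=
  (∀ a, Function.Injective (C a)) ∧ (∀ a i, C a i ∈ A) ∧
    Function.Injective fun a => rotations (C a)

/-- All arcs prescribed by the tuple of cyclic sequences are present. -/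
def HasArcs {j : ℕ} (f : Fin n × Fin k → Fin n) (C : Fin j → ZMod p → Fin n) : Prop :=
  ∀ a i, ∃ l, f (C a i, l) = C a (i + 1)

lemma card_cycleTuples (f : Fin n × Fin k → Fin n) (A : Set (Fin n)) (j : ℕ) :
    (Finset.univ.filter fun C : Fin j → ZMod p → Fin n => IsCycleTuple A C ∧ HasArcs f C).card =
      p ^ j * (j.factorial * (numCycles f A p).choose j) := by
  rw [← Nat.descFactorial_eq_factorial_mul_choose, numCycles_eq,
    ← card_tuples_of_card_fiber (rootedCycles f A p) rotations (Nat.one_le_iff_ne_zero.2 (NeZero.ne p))]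
  · refine congrArg Finset.card (Finset.ext fun C => ?_)
    simp only [Finset.mem_filter, Finset.mem_univ, true_and]
    simp only [IsCycleTuple, HasArcs, rootedCycles, Finset.mem_filter, Finset.mem_univ, true_and]
    constructor
    · rintro ⟨⟨h1, h2, h3⟩, h4⟩
      exact ⟨fun a => ⟨h1 a, h2 a, h4 a⟩, h3⟩
    · rintro ⟨h, h3⟩
      exact ⟨⟨fun a => (h a).1, fun a => (h a).2.1, h3⟩, fun a => (h a).2.2⟩
  · intro c hc
    have hc' := hc
    simp only [rootedCycles, Finset.mem_filter, Finset.mem_univ, true_and] at hc'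
    refine Eq.trans (congrArg Finset.card (Finset.ext fun d => ?_)) (card_rotations hc'.1)
    simp only [Finset.mem_filter, rotations_eq_iff, and_iff_right_iff_imp]
    intro hd
    obtain ⟨t, ht⟩ := mem_rotations.1 hd
    simp only [rootedCycles, Finset.mem_filter, Finset.mem_univ, true_and, ht]
    refine ⟨fun a b h => ?_, fun i => hc'.2.1 _, fun i => ?_⟩
    · rw [ht, ht] at h
      simpa using hc'.1 h
    · obtain ⟨l, hl⟩ := hc'.2.2 (i + t)
      exact ⟨l, by rw [hl]; congr 1; ring⟩

lemma card_image_lt_card_image_arcs {j : ℕ} {A : Set (Fin n)} {C : Fin j → ZMod p → Fin n}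
    (hC : IsCycleTuple A C) (hinj : ¬ Function.Injective fun x : Fin j × ZMod p => C x.1 x.2) :
    (Finset.univ.image fun x : Fin j × ZMod p => C x.1 x.2).card <
      (Finset.univ.image fun x : Fin j × ZMod p => (C x.1 x.2, C x.1 (x.2 + 1))).card := by
  by_contra! hle
  have himg : (Finset.univ.image fun x : Fin j × ZMod p => C x.1 x.2) =
      (Finset.univ.image fun x : Fin j × ZMod p => (C x.1 x.2, C x.1 (x.2 + 1))).image Prod.fst := by
    rw [Finset.image_image]; rfl
  rw [himg] at hle
  have hfst := Finset.card_image_iff.1 (le_antisymm Finset.card_image_le hle)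
  have hstep : ∀ a b s t, C a s = C b t → C a (s + 1) = C b (t + 1) := by
    intro a b s t h
    exact congrArg Prod.snd (hfst (x₁ := (C a s, C a (s + 1))) (x₂ := (C b t, C b (t + 1)))
      (by simp only [Finset.coe_image, Finset.coe_univ, Set.image_univ]; exact ⟨(a, s), rfl⟩)
      (by simp only [Finset.coe_image, Finset.coe_univ, Set.image_univ]; exact ⟨(b, t), rfl⟩) h)
  refine hinj ?_
  rintro ⟨a, s⟩ ⟨b, t⟩ h
  simp only at h
  have hall : ∀ i : ℕ, C a (s + i) = C b (t + i) := by
    intro i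
    induction i with
    | zero => simpa using h
    | succ i ih =>
      push_cast
      rw [← add_assoc, ← add_assoc]
      exact hstep _ _ _ _ ih
  have hab : a = b := by
    refine hC.2.2 (rotations_eq_iff.2 (mem_rotations.2 ⟨t - s, fun i => ?_⟩))
    have := hall (i - s).val
    rw [ZMod.natCast_zmod_val] at this
    rw [show s + (i - s) = i by ring] at this
    rw [this]
    congr 1
    ring
  subst hab
  rw [hC.1 a h]

lemma isCycleTuple_of_injective {j : ℕ} {A : Set (Fin n)} {C : Fin j → ZMod p → Fin n}
    (hA : ∀ a i, C a i ∈ A) (h : Function.Injective fun x : Fin j × ZMod p => C x.1 x.2) :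
    IsCycleTuple A C := by
  refine ⟨fun a s t e => congrArg Prod.snd (h (a₁ := (a, s)) (a₂ := (a, t)) e), hA,
    fun a b e => ?_⟩
  obtain ⟨t, ht⟩ := mem_rotations.1 (rotations_eq_iff.1 e)
  exact congrArg Prod.fst (h (a₁ := (a, 0)) (a₂ := (b, 0 + t)) (ht 0))

end CycleTuples

section ArcProbabilities

lemma card_filter_forall_mem {α β ι : Type*} [Fintype α] [DecidableEq α] [Fintype β]
    [Nonempty β] [Fintype ι] {u : ι → α} (hu : Function.Injective u) (B : ι → Finset β)
    [DecidablePred fun F : α → β => ∀ x, F (u x) ∈ B x] :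
    ((Finset.univ.filter fun F : α → β => ∀ x, F (u x) ∈ B x).card : ℝ) /
      Fintype.card (α → β) = ∏ x, ((B x).card : ℝ) / Fintype.card β := by
  set D : α → Finset β := fun a => if h : ∃ x, u x = a then B h.choose else Finset.univ with hD
  have hDu : ∀ x, D (u x) = B x := by
    intro x
    have h : ∃ y, u y = u x := ⟨x, rfl⟩
    rw [hD]
    simp only [dif_pos h]
    rw [hu h.choose_spec]
  have hDn : ∀ a, a ∉ Set.range u → D a = Finset.univ := by
    intro a ha
    exact dif_neg ha
  have hset : (Finset.univ.filter fun F : α → β => ∀ x, F (u x) ∈ B x) = Fintype.piFinset D := by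
    ext F
    simp only [Finset.mem_filter, Finset.mem_univ, true_and, Fintype.mem_piFinset]
    constructor
    · intro h a
      by_cases ha : a ∈ Set.range u
      · obtain ⟨x, rfl⟩ := ha
        rw [hDu]
        exact h x
      · rw [hDn a ha]
        exact Finset.mem_univ _
    · intro h x
      rw [← hDu]
      exact h _
  have hβ : (Fintype.card β : ℝ) ≠ 0 := by exact_mod_cast Fintype.card_ne_zero
  rw [hset, Fintype.card_piFinset, Fintype.card_fun, Nat.cast_prod, Nat.cast_pow,
    ← Finset.card_univ (α := α), ← Finset.prod_const, ← Finset.prod_div_distrib]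
  symm
  refine Fintype.prod_of_injective u hu _ _ (fun a ha => ?_) fun x => ?_
  · rw [hDn a ha, Finset.card_univ, div_self hβ]
  · rw [hDu]

lemma prob_forall_exists_arc {n k : ℕ} (hn : 1 ≤ n) {ι : Type*} [Fintype ι] {u : ι → Fin n}
    (hu : Function.Injective u) (w : ι → Fin n) :
    prob n k (fun f => ∀ x, ∃ l, f (u x, l) = w x) =
      (1 - (1 - 1 / (n : ℝ)) ^ k) ^ Fintype.card ι := by
  have : NeZero n := ⟨by omega⟩
  have hn0 : (n : ℝ) ≠ 0 := by exact_mod_cast (by omega : n ≠ 0)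
  have hB : ∀ b : Fin n, (((Finset.univ.filter fun g : Fin k → Fin n => ∃ l, g l = b).card : ℝ) /
      Fintype.card (Fin k → Fin n)) = 1 - (1 - 1 / (n : ℝ)) ^ k := by
    intro b
    have h1 := card_filter_forall_mem (α := Fin k) (β := Fin n) Function.injective_id
      (fun _ => ({b} : Finset (Fin n))ᶜ)
    have h2 := Finset.card_filter_add_card_filter_not (s := (Finset.univ : Finset (Fin k → Fin n)))
      (fun g => ∃ l, g l = b)
    have h3 : (Finset.univ.filter fun g : Fin k → Fin n => ¬ ∃ l, g l = b) =
        Finset.univ.filter fun F : Fin k → Fin n => ∀ x, F (id x) ∈ ({b} : Finset (Fin n))ᶜ := by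
      ext g
      simp
    rw [h3, Finset.card_univ] at h2
    have h4 : (Fintype.card (Fin k → Fin n) : ℝ) ≠ 0 := by exact_mod_cast Fintype.card_ne_zero
    have h5 : ((({b} : Finset (Fin n))ᶜ.card : ℝ)) / Fintype.card (Fin n) = 1 - 1 / n := by
      rw [Finset.card_compl, Finset.card_singleton, Fintype.card_fin, Nat.cast_sub hn]
      field_simp
      simp
    rw [Finset.prod_congr rfl fun _ _ => h5] at h1
    simp only [Finset.prod_const, Finset.card_univ, Fintype.card_fin] at h1
    rw [← h1, eq_sub_iff_add_eq, ← add_div, ← Nat.cast_add, h2]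
    exact div_self h4
  have h := card_filter_forall_mem (α := Fin n) (β := Fin k → Fin n) hu
    (fun x => Finset.univ.filter fun g : Fin k → Fin n => ∃ l, g l = w x)
  simp only [hB, Finset.prod_const, Finset.card_univ] at h
  rw [← h, prob]
  congr 2
  · refine Finset.card_bij' (fun f _ a l => f (a, l)) (fun F _ x => F x.1 x.2) ?_ ?_ ?_ ?_
    · intro f hf
      simpa using hf
    · intro f hf
      simpa using hf
    · intro f hf
      rfl
    · intro f hf
      rfl
  · exact Fintype.card_congr (Equiv.curry _ _ _)

lemma prob_forall_arc_le {n k : ℕ} (hn : 1 ≤ n) (E : Finset (Fin n × Fin n)) (h : E → Fin k) :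
    prob n k (fun f => ∀ e : E, f (e.1.1, h e) = e.1.2) ≤ (1 / (n : ℝ)) ^ E.card := by
  have : NeZero n := ⟨by omega⟩
  by_cases hinj : Function.Injective fun e : E => (e.1.1, h e)
  · have := card_filter_forall_mem (β := Fin n) hinj (fun e => {e.1.2})
    simp only [Finset.card_singleton, Fintype.card_fin, Finset.prod_const, Finset.card_univ,
      Fintype.card_coe, Nat.cast_one, Finset.mem_singleton] at this
    rw [← this]
    unfold prob
    refine le_of_eq ?_
    congr!
  · refine le_trans (le_of_eq ?_) (by positivity)
    rw [prob, div_eq_zero_iff, Nat.cast_eq_zero, Finset.card_eq_zero]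
    refine Or.inl (Finset.eq_empty_of_forall_notMem fun f hf => ?_)
    simp only [Finset.mem_filter, Finset.mem_univ, true_and] at hf
    refine hinj fun e e' he => Subtype.ext ?_
    simp only [Prod.mk.injEq] at he
    refine Prod.ext he.1 ?_
    rw [← hf e, ← hf e', he.1, he.2]

lemma prob_forall_exists_arc_le {n k : ℕ} (hn : 1 ≤ n) (E : Finset (Fin n × Fin n)) :
    prob n k (fun f => ∀ e ∈ E, ∃ l, f (e.1, l) = e.2) ≤ (k : ℝ) ^ E.card * (1 / (n : ℝ)) ^ E.card := by
  calc _ ≤ prob n k (fun f => ∃ h ∈ (Finset.univ : Finset (E → Fin k)),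
        ∀ e : E, f (e.1.1, h e) = e.1.2) := by
        refine prob_mono fun f hf => ?_
        choose h hh using fun e : E => hf e e.2
        exact ⟨h, Finset.mem_univ _, hh⟩
    _ ≤ ∑ h : E → Fin k, prob n k (fun f => ∀ e : E, f (e.1.1, h e) = e.1.2) :=
        prob_exists_le_sum _ _
    _ ≤ ∑ _h : E → Fin k, (1 / (n : ℝ)) ^ E.card :=
        Finset.sum_le_sum fun h _ => prob_forall_arc_le hn E h
    _ = _ := by simp

lemma sum_pow_card_image_le {n : ℕ} (hn : 1 ≤ n) {ι : Type*} [Fintype ι] [DecidableEq ι] :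
    ∑ C : ι → Fin n, (1 / (n : ℝ)) ^ (Finset.univ.image C).card ≤
      (Fintype.card ι + 1) * (Fintype.card ι : ℝ) ^ Fintype.card ι := by
  set d := Fintype.card ι with hd
  have hn0 : (0 : ℝ) < n := by exact_mod_cast hn
  have hmaps : ∀ C ∈ (Finset.univ : Finset (ι → Fin n)),
      (Finset.univ.image C).card ∈ Finset.range (d + 1) := by
    intro C _
    rw [Finset.mem_range, Nat.lt_succ_iff, hd, ← Finset.card_univ]
    exact Finset.card_image_le
  rw [← Finset.sum_fiberwise_of_maps_to hmaps]
  have hcard : ∀ v ∈ Finset.range (d + 1),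
      ∑ C ∈ Finset.univ.filter (fun C : ι → Fin n => (Finset.univ.image C).card = v),
        (1 / (n : ℝ)) ^ (Finset.univ.image C).card ≤ (d : ℝ) ^ d := by
    intro v hv
    have hvd : v ≤ d := Nat.lt_succ_iff.1 (Finset.mem_range.1 hv)
    have hc : (Finset.univ.filter (fun C : ι → Fin n => (Finset.univ.image C).card = v)).card ≤
        n ^ v * d ^ d := by
      calc _ ≤ ((Finset.powersetCard v Finset.univ).biUnion fun W : Finset (Fin n) =>
            Fintype.piFinset fun _ : ι => W).card := by
            refine Finset.card_le_card fun C hC => ?_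
            simp only [Finset.mem_filter, Finset.mem_univ, true_and] at hC
            simp only [Finset.mem_biUnion, Finset.mem_powersetCard, Fintype.mem_piFinset]
            exact ⟨Finset.univ.image C, ⟨Finset.subset_univ _, hC⟩, fun a => by simp⟩
        _ ≤ ∑ W ∈ Finset.powersetCard v Finset.univ, (Fintype.piFinset fun _ : ι => W).card :=
            Finset.card_biUnion_le
        _ = n.choose v * v ^ d := by
            rw [Finset.sum_congr rfl (g := fun _ => v ^ d), Finset.sum_const,
              Finset.card_powersetCard, Finset.card_univ, Fintype.card_fin, smul_eq_mul]
            intro W hW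
            rw [Fintype.card_piFinset, Finset.prod_const, (Finset.mem_powersetCard.1 hW).2,
              Finset.card_univ]
        _ ≤ n ^ v * d ^ d := Nat.mul_le_mul (Nat.choose_le_pow _ _) (Nat.pow_le_pow_left hvd d)
    rw [Finset.sum_congr rfl (g := fun _ => (1 / (n : ℝ)) ^ v) fun C hC => by
      rw [(Finset.mem_filter.1 hC).2], Finset.sum_const, nsmul_eq_mul]
    calc _ ≤ ((n ^ v * d ^ d : ℕ) : ℝ) * (1 / (n : ℝ)) ^ v := by
          gcongr
      _ = _ := by rw [one_div, inv_pow]; push_cast; field_simp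
  calc _ ≤ ∑ _v ∈ Finset.range (d + 1), (d : ℝ) ^ d := Finset.sum_le_sum hcard
    _ = _ := by simp

end ArcProbabilities

section Moments

/-- The probability that a fixed arc is present. -/
noncomputable def arcProb (n k : ℕ) : ℝ := 1 - (1 - 1 / (n : ℝ)) ^ k

variable {n k : ℕ} {p : ℕ} [NeZero p]

lemma prob_hasArcs_le (hn : 1 ≤ n) (hk : 1 ≤ k) {j : ℕ} {A : Set (Fin n)}
    {C : Fin j → ZMod p → Fin n} (hC : IsCycleTuple A C)
    (hinj : ¬ Function.Injective fun x : Fin j × ZMod p => C x.1 x.2) :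
    prob n k (fun f => HasArcs f C) ≤ (k : ℝ) ^ (j * p) * (1 / n) *
      (1 / (n : ℝ)) ^ (Finset.univ.image fun x : Fin j × ZMod p => C x.1 x.2).card := by
  set E := Finset.univ.image fun x : Fin j × ZMod p => (C x.1 x.2, C x.1 (x.2 + 1)) with hE
  have hlt := card_image_lt_card_image_arcs hC hinj
  have hEd : E.card ≤ j * p := by
    refine Finset.card_image_le.trans ?_
    simp [ZMod.card]
  have hn1 : (1 : ℝ) ≤ n := by exact_mod_cast hn
  have hk1 : (1 : ℝ) ≤ k := by exact_mod_cast hk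
  calc prob n k (fun f => HasArcs f C) ≤ prob n k (fun f => ∀ e ∈ E, ∃ l, f (e.1, l) = e.2) := by
        refine prob_mono fun f hf e he => ?_
        obtain ⟨x, -, rfl⟩ := Finset.mem_image.1 he
        exact hf _ _
    _ ≤ (k : ℝ) ^ E.card * (1 / (n : ℝ)) ^ E.card := prob_forall_exists_arc_le hn E
    _ ≤ (k : ℝ) ^ (j * p) *
        (1 / (n : ℝ)) ^ ((Finset.univ.image fun x : Fin j × ZMod p => C x.1 x.2).card + 1) := by
        refine mul_le_mul (pow_le_pow_right₀ hk1 hEd) ?_ (by positivity) (by positivity)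
        refine pow_le_pow_of_le_one (by positivity) ?_ hlt
        rw [div_le_one (by linarith)]
        exact hn1
    _ = _ := by rw [pow_succ]; ring

lemma sum_choose_numCycles (A : Set (Fin n)) (j : ℕ) :
    (∑ f : Fin n × Fin k → Fin n, ((numCycles f A p).choose j : ℝ)) /
      Fintype.card (Fin n × Fin k → Fin n) = (1 / ((p : ℝ) ^ j * j.factorial)) *
        ∑ C ∈ Finset.univ.filter (fun C : Fin j → ZMod p → Fin n => IsCycleTuple A C),
          prob n k (fun f => HasArcs f C) := by
  have hp : (p : ℝ) ≠ 0 := by exact_mod_cast NeZero.ne p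
  have hj : (j.factorial : ℝ) ≠ 0 := by exact_mod_cast j.factorial_ne_zero
  have h : ∀ f : Fin n × Fin k → Fin n, ((numCycles f A p).choose j : ℝ) =
      1 / ((p : ℝ) ^ j * j.factorial) *
        ∑ C ∈ Finset.univ.filter (fun C : Fin j → ZMod p → Fin n => IsCycleTuple A C),
          if HasArcs f C then (1 : ℝ) else 0 := by
    intro f
    rw [Finset.sum_boole, Finset.filter_filter, card_cycleTuples]
    push_cast
    field_simp
  rw [Finset.sum_congr rfl fun f _ => h f, ← Finset.mul_sum, Finset.sum_comm, mul_div_assoc,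
    Finset.sum_div]
  congr 1
  refine Finset.sum_congr rfl fun C _ => ?_
  rw [Finset.sum_boole, prob]

lemma card_injective_cycleTuples (R : Finset (Fin n)) (j : ℕ) :
    (Finset.univ.filter fun C : Fin j → ZMod p → Fin n => IsCycleTuple (R : Set (Fin n)) C ∧
      Function.Injective fun x : Fin j × ZMod p => C x.1 x.2).card =
      R.card.descFactorial (j * p) := by
  have e : Fin (j * p) ≃ Fin j × ZMod p := Fintype.equivOfCardEq (by simp [ZMod.card])
  rw [← card_injective_tuples R (j * p)]
  refine Finset.card_bij' (fun C _ i => C (e i).1 (e i).2) (fun D _ a t => D (e.symm (a, t)))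
    ?_ ?_ ?_ ?_
  · intro C hC
    simp only [Finset.mem_filter, Finset.mem_univ, true_and] at hC ⊢
    exact ⟨fun a => by simpa using hC.1.2.1 _ _, hC.2.comp e.injective⟩
  · intro D hD
    simp only [Finset.mem_filter, Finset.mem_univ, true_and] at hD ⊢
    have hinj : Function.Injective fun x : Fin j × ZMod p => D (e.symm (x.1, x.2)) :=
      hD.2.comp e.symm.injective
    exact ⟨isCycleTuple_of_injective (fun a i => hD.1 _) hinj, hinj⟩
  · intro C _
    simp
  · intro D _
    simp

lemma abs_sum_prob_hasArcs_sub_le (hn : 1 ≤ n) (hk : 1 ≤ k) (R : Finset (Fin n)) (j : ℕ) :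
    |∑ C ∈ Finset.univ.filter (fun C : Fin j → ZMod p → Fin n => IsCycleTuple (R : Set (Fin n)) C),
        prob n k (fun f => HasArcs f C) -
      R.card.descFactorial (j * p) * arcProb n k ^ (j * p)| ≤
      (k : ℝ) ^ (j * p) * ((((j * p : ℕ) : ℝ) + 1) * ((j * p : ℕ) : ℝ) ^ (j * p)) * (1 / n) := by
  have hcard : Fintype.card (Fin j × ZMod p) = j * p := by simp [ZMod.card]
  rw [← Finset.sum_filter_add_sum_filter_not _ fun C : Fin j → ZMod p → Fin n =>
    Function.Injective fun x : Fin j × ZMod p => C x.1 x.2, Finset.filter_filter]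
  have h1 : ∑ C ∈ Finset.univ.filter (fun C : Fin j → ZMod p → Fin n =>
      IsCycleTuple (R : Set (Fin n)) C ∧ Function.Injective fun x : Fin j × ZMod p => C x.1 x.2),
        prob n k (fun f => HasArcs f C) = R.card.descFactorial (j * p) * arcProb n k ^ (j * p) := by
    rw [← card_injective_cycleTuples, ← nsmul_eq_mul, ← Finset.sum_const]
    refine Finset.sum_congr rfl fun C hC => ?_
    simp only [Finset.mem_filter, Finset.mem_univ, true_and] at hC
    rw [arcProb, ← hcard, ← prob_forall_exists_arc hn hC.2 fun x => C x.1 (x.2 + 1)]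
    congr 1
    ext f
    simp [HasArcs]
  rw [h1, add_sub_cancel_left, abs_of_nonneg (Finset.sum_nonneg fun _ _ => prob_nonneg _ _ _)]
  calc _ ≤ ∑ C ∈ (Finset.univ.filter fun C : Fin j → ZMod p → Fin n =>
        IsCycleTuple (R : Set (Fin n)) C).filter fun C =>
          ¬ Function.Injective fun x : Fin j × ZMod p => C x.1 x.2, (k : ℝ) ^ (j * p) * (1 / n) *
      (1 / (n : ℝ)) ^ (Finset.univ.image fun x : Fin j × ZMod p => C x.1 x.2).card := by
        refine Finset.sum_le_sum fun C hC => ?_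
        simp only [Finset.mem_filter, Finset.mem_univ, true_and] at hC
        exact prob_hasArcs_le hn hk hC.1 hC.2
    _ ≤ ∑ C : Fin j → ZMod p → Fin n, (k : ℝ) ^ (j * p) * (1 / n) *
      (1 / (n : ℝ)) ^ (Finset.univ.image fun x : Fin j × ZMod p => C x.1 x.2).card :=
        Finset.sum_le_sum_of_subset_of_nonneg (Finset.subset_univ _) fun _ _ _ => by positivity
    _ = (k : ℝ) ^ (j * p) * (1 / n) * ∑ C : Fin j × ZMod p → Fin n,
        (1 / (n : ℝ)) ^ (Finset.univ.image C).card := by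
        rw [Finset.mul_sum]
        refine Fintype.sum_equiv (Equiv.curry _ _ _).symm _ _ fun C => ?_
        rfl
    _ ≤ (k : ℝ) ^ (j * p) * (1 / n) * ((((j * p : ℕ) : ℝ) + 1) * ((j * p : ℕ) : ℝ) ^ (j * p)) := by
        have := sum_pow_card_image_le hn (ι := Fin j × ZMod p)
        rw [hcard] at this
        gcongr
    _ = _ := by ring

lemma tendsto_mul_arcProb (k : ℕ) :
    Tendsto (fun n : ℕ => (n : ℝ) * arcProb n k) atTop (nhds k) := by
  have h : Tendsto (fun n : ℕ => ∑ i ∈ Finset.range k, (1 - 1 / (n : ℝ)) ^ i) atTop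
      (nhds (∑ _i ∈ Finset.range k, (1 - 0) ^ _i)) :=
    tendsto_finsetSum _ fun i _ => (tendsto_const_nhds.sub tendsto_one_div_atTop_nhds_zero_nat).pow i
  simp only [sub_zero, one_pow, Finset.sum_const, Finset.card_range, nsmul_eq_mul, mul_one] at h
  refine h.congr' ?_
  filter_upwards [eventually_ge_atTop 1] with n hn
  have hn0 : (n : ℝ) ≠ 0 := by exact_mod_cast (by omega : n ≠ 0)
  have := mul_neg_geom_sum (1 - 1 / (n : ℝ)) k
  rw [arcProb, ← this]
  field_simp
  ring

lemma tendsto_descFactorial_div {ι : Type*} {l : Filter ι} {N r : ι → ℕ} {μ : ℝ}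
    (hN : Tendsto N l atTop) (hr : Tendsto (fun i => (r i : ℝ) / N i) l (nhds μ)) (d : ℕ) :
    Tendsto (fun i => ((r i).descFactorial d : ℝ) / (N i : ℝ) ^ d) l (nhds (μ ^ d)) := by
  induction d with
  | zero => simpa using tendsto_const_nhds
  | succ d ih =>
    have h0 : Tendsto (fun i => (d : ℝ) / N i) l (nhds 0) :=
      (tendsto_const_div_atTop_nhds_zero_nat (d : ℝ)).comp hN
    have h1 : Tendsto (fun i => ((r i - d : ℕ) : ℝ) / N i) l (nhds μ) := by
      refine tendsto_of_tendsto_of_tendsto_of_le_of_le (by simpa using hr.sub h0) hr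
        (fun i => ?_) (fun i => ?_)
      · simp only
        rw [← sub_div]
        gcongr
        rw [sub_le_iff_le_add]
        exact_mod_cast (by omega : r i ≤ r i - d + d)
      · simp only
        gcongr
        omega
    rw [pow_succ, mul_comm]
    refine (h1.mul ih).congr fun i => ?_
    rw [Nat.descFactorial_succ, pow_succ, Nat.cast_mul, div_mul_div_comm, mul_comm (N i : ℝ)]

lemma tendsto_sum_choose_numCycles {ι : Type*} {l : Filter ι} {N : ι → ℕ}
    (R : ∀ i, Finset (Fin (N i))) {μ : ℝ} (hk : 1 ≤ k) (hN : Tendsto N l atTop)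
    (hr : Tendsto (fun i => ((R i).card : ℝ) / N i) l (nhds μ)) (j : ℕ) :
    Tendsto (fun i => (∑ f : Fin (N i) × Fin k → Fin (N i), ((numCycles f (R i) p).choose j : ℝ)) /
      Fintype.card (Fin (N i) × Fin k → Fin (N i))) l
      (nhds (((k * μ) ^ p / p) ^ j / j.factorial)) := by
  have hp : (p : ℝ) ≠ 0 := by exact_mod_cast NeZero.ne p
  have hj : (j.factorial : ℝ) ≠ 0 := by exact_mod_cast j.factorial_ne_zero
  have hmain : Tendsto (fun i => ((R i).card.descFactorial (j * p) : ℝ) * arcProb (N i) k ^ (j * p))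
      l (nhds (μ ^ (j * p) * (k : ℝ) ^ (j * p))) := by
    refine ((tendsto_descFactorial_div hN hr (j * p)).mul
      (((tendsto_mul_arcProb k).comp hN).pow (j * p))).congr' ?_
    filter_upwards [hN.eventually_ge_atTop 1] with i hi
    have : (N i : ℝ) ≠ 0 := by exact_mod_cast (by omega : N i ≠ 0)
    simp only [Function.comp, mul_pow]
    field_simp
  have hdiff : Tendsto (fun i => ∑ C ∈ Finset.univ.filter (fun C : Fin j → ZMod p → Fin (N i) =>
      IsCycleTuple (R i : Set (Fin (N i))) C), prob (N i) k (fun f => HasArcs f C) -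
      (R i).card.descFactorial (j * p) * arcProb (N i) k ^ (j * p)) l (nhds 0) := by
    have h0 := ((tendsto_one_div_atTop_nhds_zero_nat (𝕜 := ℝ)).comp hN).const_mul
      ((k : ℝ) ^ (j * p) * ((((j * p : ℕ) : ℝ) + 1) * ((j * p : ℕ) : ℝ) ^ (j * p)))
    rw [mul_zero] at h0
    refine squeeze_zero_norm' ?_ h0
    filter_upwards [hN.eventually_ge_atTop 1] with i hi
    exact abs_sum_prob_hasArcs_sub_le hi hk (R i) j
  have h := (hdiff.add hmain).const_mul (1 / ((p : ℝ) ^ j * j.factorial))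
  convert h using 2 with i
  · rw [sum_choose_numCycles, sub_add_cancel]
  · rw [zero_add, div_pow, mul_pow, mul_pow, ← pow_mul, ← pow_mul, mul_comm p j]
    field_simp

lemma exists_abs_prob_numCycles_sub_lt (hk : 1 ≤ k) (μ : ℝ) (m : ℕ) {δ : ℝ} (hδ : 0 < δ) :
    ∃ ε > 0, ∃ M, ∀ n ≥ M, ∀ R : Finset (Fin n), |(R.card : ℝ) / n - μ| < ε →
      |prob n k (fun f => numCycles f R p = m) -
        Real.exp (-((k * μ) ^ p / p)) * ((k * μ) ^ p / p) ^ m / m.factorial| < δ := by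
  let l : Filter (Σ n, Finset (Fin n)) :=
    comap Sigma.fst atTop ⊓ comap (fun x => (x.2.card : ℝ) / x.1) (nhds μ)
  have h := tendsto_poisson_of_binomial_moments (l := l)
    (fun (x : Σ n, Finset (Fin n)) (f : Fin x.1 × Fin k → Fin x.1) => numCycles f x.2 p)
    ((k * μ) ^ p / p)
    (tendsto_sum_choose_numCycles (fun x : Σ n, Finset (Fin n) => x.2) hk
      (tendsto_comap.mono_left inf_le_left) (tendsto_comap.mono_left inf_le_right)) m
  have hb := ((atTop_basis.comap Sigma.fst).inf
    ((Metric.nhds_basis_ball (x := μ)).comap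
      (fun x : Σ n, Finset (Fin n) => (x.2.card : ℝ) / x.1)))
  obtain ⟨⟨M, ε⟩, ⟨-, hε⟩, hM⟩ := hb.eventually_iff.1 (Metric.tendsto_nhds.1 h δ hδ)
  refine ⟨ε, hε, M, fun n hn R hR => ?_⟩
  have := hM (x := ⟨n, R⟩) ⟨hn, hR⟩
  rw [Real.dist_eq] at this
  unfold prob
  convert this

end Moments

section Independence

variable {n k : ℕ}

lemma prob_and_eq_mul {A B : (Fin n × Fin k → Fin n) → Prop} (S : Set (Fin n))
    (hA : ∀ f g, (∀ v ∈ S, ∀ i, f (v, i) = g (v, i)) → A f → A g)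
    (hB : ∀ f g, (∀ v ∉ S, ∀ i, f (v, i) = g (v, i)) → B f → B g) :
    prob n k (fun f => A f ∧ B f) = prob n k A * prob n k B := by
  let mix : (Fin n × Fin k → Fin n) → (Fin n × Fin k → Fin n) → Fin n × Fin k → Fin n :=
    fun f g x => if x.1 ∈ S then f x else g x
  have hmix : ∀ f g, mix (mix f g) (mix g f) = f := by
    intro f g
    ext x : 1
    by_cases h : x.1 ∈ S <;> simp [mix, h]
  have hS : ∀ f g, ∀ v ∈ S, ∀ i, mix f g (v, i) = f (v, i) := fun f g v hv i => if_pos hv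
  have hS' : ∀ f g, ∀ v ∉ S, ∀ i, mix f g (v, i) = g (v, i) := fun f g v hv i => if_neg hv
  have hcard : (Finset.univ.filter fun f => A f ∧ B f).card *
      Fintype.card (Fin n × Fin k → Fin n) =
      (Finset.univ.filter A).card * (Finset.univ.filter B).card := by
    rw [← Finset.card_univ, ← Finset.card_product, ← Finset.card_product]
    refine Finset.card_bij' (fun x _ => (mix x.1 x.2, mix x.2 x.1))
      (fun x _ => (mix x.1 x.2, mix x.2 x.1)) ?_ ?_ ?_ ?_
    · intro x hx
      simp only [Finset.mem_product, Finset.mem_filter, Finset.mem_univ, true_and, and_true]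
        at hx ⊢
      exact ⟨hA _ _ (fun v hv i => (hS _ _ v hv i).symm) hx.1,
        hB _ _ (fun v hv i => (hS' _ _ v hv i).symm) hx.2⟩
    · intro x hx
      simp only [Finset.mem_product, Finset.mem_filter, Finset.mem_univ, true_and, and_true]
        at hx ⊢
      exact ⟨hA _ _ (fun v hv i => (hS _ _ v hv i).symm) hx.1,
        hB _ _ (fun v hv i => (hS' _ _ v hv i).symm) hx.2⟩
    · intro x _
      exact Prod.ext (hmix _ _) (hmix _ _)
    · intro x _
      exact Prod.ext (hmix _ _) (hmix _ _)
  rcases eq_or_ne (Fintype.card (Fin n × Fin k → Fin n) : ℝ) 0 with h0 | h0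
  · simp only [prob, h0, div_zero, mul_zero]
  · rw [prob, prob, prob, div_mul_div_comm, div_eq_div_iff h0 (mul_ne_zero h0 h0), ← mul_assoc]
    congr 1
    rw [← Nat.cast_mul, ← Nat.cast_mul, Nat.cast_inj]
    convert hcard

lemma IsClosedStrConn.congr {f g : Fin n × Fin k → Fin n} {S : Set (Fin n)}
    (h : ∀ v ∈ S, ∀ i, f (v, i) = g (v, i)) (hf : IsClosedStrConn f S) : IsClosedStrConn g S := by
  refine ⟨fun v hv i => h v hv i ▸ hf.1 v hv i, hf.2.1, fun u hu v hv => ?_⟩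
  have huv := hf.2.2 u hu v hv
  clear hv
  induction huv with
  | refl => exact .refl
  | tail huw hw ih =>
    obtain ⟨i, rfl⟩ := hw
    exact ih.tail ⟨i, (h _ (hf.1.mem_of_reaches hu huw) i).symm⟩

lemma numCycles_congr {f g : Fin n × Fin k → Fin n} {S : Set (Fin n)}
    (h : ∀ v ∈ S, ∀ i, f (v, i) = g (v, i)) (p : ℕ) [NeZero p] :
    numCycles f S p = numCycles g S p := by
  rw [numCycles_eq, numCycles_eq]
  congr 2
  ext c
  simp only [rootedCycles, Finset.mem_filter, Finset.mem_univ, true_and]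
  refine and_congr_right fun _ => and_congr_right fun hc => forall_congr' fun j => ?_
  simp only [h _ (hc j)]

lemma prob_isClosedStrConn_and_numCycles (S : Set (Fin n)) (p : ℕ) [NeZero p] (m : ℕ) :
    prob n k (fun f => IsClosedStrConn f S ∧ numCycles f Sᶜ p = m) =
      prob n k (fun f => IsClosedStrConn f S) * prob n k (fun f => numCycles f Sᶜ p = m) := by
  refine prob_and_eq_mul S (fun f g h hf => hf.congr h) fun f g h hf => ?_
  rw [← numCycles_congr (f := f) (S := Sᶜ) h, hf]

end Independence

section Assembly

variable {n k : ℕ}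

lemma prob_exists_eq_sum {ι : Type*} (s : Finset ι) (P : ι → (Fin n × Fin k → Fin n) → Prop)
    (h : ∀ f, ∀ i ∈ s, ∀ j ∈ s, P i f → P j f → i = j) :
    prob n k (fun f => ∃ i ∈ s, P i f) = ∑ i ∈ s, prob n k (P i) := by
  unfold prob
  rw [← Finset.sum_div, ← Nat.cast_sum, ← Finset.card_biUnion]
  · congr 3
    ext f
    simp
  · intro i hi j hj hij
    refine Finset.disjoint_left.2 fun f hf hf' => hij ?_
    simp only [Finset.mem_filter, Finset.mem_univ, true_and] at hf hf'
    exact h f i hi j hj hf hf'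

lemma prob_le_add {P Q R : (Fin n × Fin k → Fin n) → Prop} (h : ∀ f, P f → Q f ∨ R f) :
    prob n k P ≤ prob n k Q + prob n k R := by
  unfold prob
  rw [← add_div, ← Nat.cast_add]
  gcongr
  refine (Finset.card_le_card fun f hf => ?_).trans (Finset.card_union_le _ _)
  simp only [Finset.mem_filter, Finset.mem_union, Finset.mem_univ, true_and] at hf ⊢
  exact h f hf

lemma prob_true (hn : 1 ≤ n) : prob n k (fun _ => True) = 1 := by
  have : NeZero n := ⟨by omega⟩
  simp only [prob, Finset.filter_true, Finset.card_univ]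
  exact div_self (by exact_mod_cast Fintype.card_ne_zero)

lemma abs_prob_giant_sub_le (hn : 1 ≤ n) {ν ε δ r : ℝ} (hν : 1 / 2 < ν - ε) {p : ℕ} [NeZero p]
    {m : ℕ} (hδ : ∀ S : Finset (Fin n), |(S.card : ℝ) / n - ν| < ε →
      |prob n k (fun f => numCycles f (S : Set (Fin n))ᶜ p = m) - r| ≤ δ) (hδ0 : 0 ≤ δ) :
    |prob n k (fun f => ∃ G : Set (Fin n), IsGiant f G ∧ numCycles f Gᶜ p = m) - r| ≤
      δ + (1 + |r|) * prob n k fun f => ∃ S : Finset (Fin n),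
        IsClosedStrConn f S ∧ ε ≤ |(S.card : ℝ) / n - ν| := by
  have : NeZero n := ⟨by omega⟩
  have hn0 : (0 : ℝ) < n := by exact_mod_cast hn
  set good : Finset (Finset (Fin n)) := Finset.univ.filter fun S => |(S.card : ℝ) / n - ν| < ε
    with hgood
  have hg : ∀ {S}, S ∈ good ↔ |(S.card : ℝ) / n - ν| < ε := by simp [hgood]
  have hhalf : ∀ S ∈ good, n < 2 * (S : Set (Fin n)).ncard := by
    intro S hS
    rw [Set.ncard_coe_finset]
    have h1 := (abs_lt.1 (hg.1 hS)).1
    have h2 : 1 / 2 < (S.card : ℝ) / n := by linarith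
    rw [div_lt_div_iff₀ two_pos hn0] at h2
    have h3 : (n : ℝ) < ((2 * S.card : ℕ) : ℝ) := by push_cast; linarith
    exact_mod_cast h3
  have huniq : ∀ f : Fin n × Fin k → Fin n, ∀ S ∈ good, ∀ T ∈ good, IsClosedStrConn f S →
      IsClosedStrConn f T → S = T := by
    intro f S hS T hT hfS hfT
    refine Finset.coe_injective ?_
    rcases le_total (S : Set (Fin n)).ncard (T : Set (Fin n)).ncard with h | h
    · exact hfS.eq_of_half_lt hfT (hhalf S hS) h
    · exact (hfT.eq_of_half_lt hfS (hhalf T hT) h).symm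
  set b := prob n k fun f => ∃ S : Finset (Fin n),
        IsClosedStrConn f S ∧ ε ≤ |(S.card : ℝ) / n - ν| with hb
  set P := prob n k fun f => ∃ S ∈ good, IsClosedStrConn f (S : Set (Fin n)) ∧
    numCycles f (S : Set (Fin n))ᶜ p = m with hP
  set T := prob n k fun f => ∃ S ∈ good, IsClosedStrConn f (S : Set (Fin n)) with hT
  have hcases : ∀ f : Fin n × Fin k → Fin n,
      (∃ S ∈ good, IsClosedStrConn f (S : Set (Fin n))) ∨ ∃ S : Finset (Fin n),
        IsClosedStrConn f S ∧ ε ≤ |(S.card : ℝ) / n - ν| := by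
    intro f
    obtain ⟨S, hS⟩ := exists_isClosedStrConn f
    have hS' : IsClosedStrConn f (S.toFinset : Set (Fin n)) := by simpa using hS
    by_cases h : S.toFinset ∈ good
    · exact Or.inl ⟨_, h, hS'⟩
    · exact Or.inr ⟨_, hS', not_lt.1 fun h' => h (hg.2 h')⟩
  have hT1 : T ≤ 1 := (prob_mono fun _ _ => trivial).trans (prob_true hn).le
  have hT2 : 1 ≤ T + b := (prob_true (k := k) hn).symm.le.trans (prob_le_add fun f _ => hcases f)
  have hPle : P ≤ prob n k (fun f => ∃ G : Set (Fin n), IsGiant f G ∧ numCycles f Gᶜ p = m) := by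
    refine prob_mono ?_
    rintro f ⟨S, hS, hf, hm⟩
    exact ⟨S, (hf.isGiant_iff (hhalf S hS) _).2 rfl, hm⟩
  have hleP : prob n k (fun f => ∃ G : Set (Fin n), IsGiant f G ∧ numCycles f Gᶜ p = m) ≤
      P + b := by
    refine prob_le_add ?_
    rintro f ⟨G, hG, hm⟩
    refine (hcases f).imp_left ?_
    rintro ⟨S, hS, hf⟩
    obtain rfl := (hf.isGiant_iff (hhalf S hS) _).1 hG
    exact ⟨S, hS, hf, hm⟩
  have hPsum : P = ∑ S ∈ good, prob n k (fun f => IsClosedStrConn f (S : Set (Fin n))) *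
      prob n k (fun f => numCycles f (S : Set (Fin n))ᶜ p = m) := by
    rw [hP, prob_exists_eq_sum good (fun S f => IsClosedStrConn f (S : Set (Fin n)) ∧
      numCycles f (S : Set (Fin n))ᶜ p = m)
      fun f S hS S' hS' h h' => huniq f S hS S' hS' h.1 h'.1]
    exact Finset.sum_congr rfl fun S _ => prob_isClosedStrConn_and_numCycles _ _ _
  have hTsum : T = ∑ S ∈ good, prob n k (fun f => IsClosedStrConn f (S : Set (Fin n))) := by
    rw [hT, prob_exists_eq_sum good (fun S f => IsClosedStrConn f (S : Set (Fin n))) huniq]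
  have hPT : |P - T * r| ≤ δ := by
    rw [hPsum, hTsum, Finset.sum_mul, ← Finset.sum_sub_distrib]
    calc _ ≤ ∑ S ∈ good, prob n k (fun f => IsClosedStrConn f (S : Set (Fin n))) * δ := by
          refine (Finset.abs_sum_le_sum_abs _ _).trans (Finset.sum_le_sum fun S hS => ?_)
          rw [← mul_sub, abs_mul, abs_of_nonneg (prob_nonneg _ _ _)]
          exact mul_le_mul_of_nonneg_left (hδ S (hg.1 hS)) (prob_nonneg _ _ _)
      _ = T * δ := by rw [← Finset.sum_mul, hTsum]
      _ ≤ δ := mul_le_of_le_one_left hδ0 hT1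
  have hTr : |T * r - r| ≤ b * |r| := by
    rw [← sub_one_mul, abs_mul, abs_of_nonpos (by linarith)]
    exact mul_le_mul_of_nonneg_right (by linarith) (abs_nonneg r)
  rw [abs_le] at *
  constructor <;> linarith [hPT.1, hPT.2, hTr.1, hTr.2]

lemma tendsto_prob_giant_numCycles (hk : 2 ≤ k) {ν : ℝ} (h0 : 0 < ν) (h1 : ν < 1)
    (hν : Real.log (1 - ν) = -(k * ν)) (p : ℕ) [NeZero p] (m : ℕ) :
    Tendsto (fun n : ℕ =>
      prob n k (fun f => ∃ G : Set (Fin n), IsGiant f G ∧ numCycles f Gᶜ p = m)) atTop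
      (nhds (Real.exp (-((k * (1 - ν)) ^ p / p)) * ((k * (1 - ν)) ^ p / p) ^ m / m.factorial)) := by
  have hhalf := half_lt_of_log_one_sub_eq (by exact_mod_cast hk) h0 hν
  set r := Real.exp (-((k * (1 - ν)) ^ p / p)) * ((k * (1 - ν)) ^ p / p) ^ m / m.factorial
  rw [Metric.tendsto_nhds]
  intro δ hδ
  obtain ⟨ε', hε', M, hM⟩ :=
    exists_abs_prob_numCycles_sub_lt (p := p) (by omega : 1 ≤ k) (1 - ν) m (half_pos hδ)
  obtain ⟨ε, hε, hlt⟩ := exists_between (lt_min hε' (lt_min (sub_pos.2 hhalf) (sub_pos.2 h1)))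
  simp only [lt_min_iff] at hlt
  have hb := (tendsto_prob_exists_isClosedStrConn hk hν hε (by linarith) (by linarith)).const_mul
    (1 + |r|)
  rw [mul_zero] at hb
  filter_upwards [eventually_ge_atTop 1, eventually_ge_atTop M,
    hb.eventually_lt_const (half_pos hδ)] with n hn hnM hbn
  have hn0 : (n : ℝ) ≠ 0 := by exact_mod_cast (by omega : n ≠ 0)
  rw [Real.dist_eq]
  refine (abs_prob_giant_sub_le hn (ν := ν) (ε := ε) (by linarith) (fun S hS => ?_)
    (half_pos hδ).le).trans_lt (by linarith)
  have h := hM n hnM Sᶜ (by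
    rw [Finset.card_compl, Fintype.card_fin, Nat.cast_sub (by simpa using Finset.card_le_univ S),
      sub_div, div_self hn0, sub_sub_sub_cancel_left, abs_sub_comm]
    linarith)
  rw [Finset.coe_compl] at h
  exact h.le

end Assembly

/-- The number of cycles of length `ℓ` of `𝒟_{n,k}` lying entirely outside the giant
converges in distribution to `Poi((kμ_k)^ℓ/ℓ)`, where `μ_k = 1 - τ_k/k`. -/
theorem cycles_length_outside_giant_poisson (k : ℕ) (hk : 2 ≤ k) (ℓ : ℕ) (hℓ : 1 ≤ ℓ)
    (τ : ℝ) (hτpos : 0 < τ) (hτ : 1 - τ / k - Real.exp (-τ) = 0)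
    (μ : ℝ) (hμ : μ = 1 - τ / k) (m : ℕ) :
    Filter.Tendsto (fun n : ℕ =>
      prob n k (fun f => ∃ G : Set (Fin n), IsGiant f G ∧ numCycles f Gᶜ ℓ = m))
      Filter.atTop
      (nhds (Real.exp (-(((k : ℝ) * μ) ^ ℓ / ℓ)) *
        (((k : ℝ) * μ) ^ ℓ / ℓ) ^ m / (Nat.factorial m))) := by
  have : NeZero ℓ := ⟨by omega⟩
  have hk0 : (k : ℝ) ≠ 0 := by exact_mod_cast (by omega : k ≠ 0)
  have hexp : 1 - τ / k = Real.exp (-τ) := by linarith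
  have hlt : τ / k < 1 := by linarith [Real.exp_pos (-τ)]
  rw [hμ]
  refine tendsto_prob_giant_numCycles hk (div_pos hτpos (by positivity)) hlt ?_ ℓ m
  rw [hexp, Real.log_exp, mul_div_cancel₀ _ hk0]
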